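/- arXiv:2412.04156 — 2 statements merged into one kernel-verified Lean document; each statement's English description precedes it below -/
import Mathlib

section
/- For every 0 < α < 1 and all sufficiently large n, the random 2-CNF Φ = Φ_{n,m} with m ~ αn clauses satisfies Pr[Y(Φ) ≥ E[Y(Φ)] + n^{0.9}] ≤ exp(−n^{0.7}), where Y(Φ) = Σ_{x ∈ V(Φ)} min{|𝒱(Φ,{x})|² + |𝒱(Φ,{¬x})|², log⁴ n}. -/
open Filter

open scoped Classical

/-- A literal is a sign (`true` = positive) together with a variable. -/
abbrev Lit (V : Type) := Bool × V

/-- A 2-clause is a disjunction of two literals. -/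
abbrev Clause (V : Type) := Lit V × Lit V

/-- A 2-CNF is a finite list of 2-clauses. -/
abbrev CNF (V : Type) := List (Clause V)

/-- The negation of a literal. -/
def Lit.negate {V : Type} (l : Lit V) : Lit V := (!l.1, l.2)

/-- A literal is satisfied by an assignment if the variable is assigned its sign. -/
def litSat {V : Type} (σ : V → Bool) (l : Lit V) : Prop := σ l.2 = l.1

/-- A clause is satisfied if one of its two literals is. -/
def clauseSat {V : Type} (σ : V → Bool) (c : Clause V) : Prop := litSat σ c.1 ∨ litSat σ c.2

/-- A 2-CNF is satisfied if all of its clauses are. -/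
def cnfSat {V : Type} (σ : V → Bool) (Φ : CNF V) : Prop := ∀ c ∈ Φ, clauseSat σ c

instance {V : Type} (σ : V → Bool) (l : Lit V) : Decidable (litSat σ l) := by
  unfold litSat; infer_instance

instance {V : Type} (σ : V → Bool) (c : Clause V) : Decidable (clauseSat σ c) := by
  unfold clauseSat; infer_instance

instance {V : Type} (σ : V → Bool) (Φ : CNF V) : Decidable (cnfSat σ Φ) := by
  unfold cnfSat; infer_instance

/-- In a proper 2-CNF, the two literals of each clause have distinct variables. -/
def validCNF {V : Type} (Φ : CNF V) : Prop := ∀ c ∈ Φ, c.1.2 ≠ c.2.2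

/-- A set `L` of literals is closed under Unit Clause Propagation on `Φ`:
whenever a clause can be written `¬ l' ∨ l''` with `l' ∈ L`, also `l'' ∈ L`. -/
def ucpClosed {V : Type} (Φ : CNF V) (L : Set (Lit V)) : Prop :=
  ∀ c ∈ Φ, (Lit.negate c.1 ∈ L → c.2 ∈ L) ∧ (Lit.negate c.2 ∈ L → c.1 ∈ L)

/-- `ℒ(Φ, {l})`: the set of literals produced by UCP from `{l}`, i.e. the least
set containing `l` that is closed under unit clause propagation. -/
def ucpLits {V : Type} (Φ : CNF V) (l : Lit V) : Set (Lit V) :=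
  ⋂₀ {L : Set (Lit V) | l ∈ L ∧ ucpClosed Φ L}

/-- `𝒱(Φ, {l})`: the variables underlying `ℒ(Φ, {l})`. -/
def ucpVars {V : Type} (Φ : CNF V) (l : Lit V) : Set V := Prod.snd '' ucpLits Φ l

/-! ### WalkSAT -/

/-- Flip the value of variable `v` in assignment `σ`. -/
def flipVar {V : Type} [DecidableEq V] (σ : V → Bool) (v : V) : V → Bool :=
  fun u => if u = v then !σ u else σ u

/-- The list of clauses of `Φ` violated by `σ`. -/
def violated {V : Type} (Φ : CNF V) (σ : V → Bool) : List (Clause V) :=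
  Φ.filter fun c => decide (¬ clauseSat σ c)

/-- One step of WalkSAT, driven by a random seed `s`.  If `σ` violates some clause,
then a violated clause is selected via `s.1 % (number of violated clauses)`
(this is a uniformly random violated clause, since `s.1` is uniform on
`Fin (Φ.length)!` and the number of violated clauses divides `(Φ.length)!`),
one of its two literals is selected via the uniform bit `s.2`, and the underlying
variable is flipped.  If `σ` satisfies `Φ`, nothing happens. -/
def wsNext {V : Type} [DecidableEq V] (Φ : CNF V) (s : ℕ × Bool) (σ : V → Bool) : V → Bool :=
  if h : (violated Φ σ).length = 0 then σ
  else
    let c := (violated Φ σ).get ⟨s.1 % (violated Φ σ).length, Nat.mod_lt _ (Nat.pos_of_ne_zero h)⟩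
    flipVar σ (if s.2 then c.1.2 else c.2.2)

/-- The space of random seeds driving one run of WalkSAT on `Φ` (at most
`100 n²` steps, each using an independent uniform pair).  The uniform measure on
this finite space makes each step's clause/literal choices uniform and independent. -/
abbrev wsSeedSpace (V : Type) [Fintype V] (Φ : CNF V) : Type :=
  Fin (100 * (Fintype.card V) ^ 2) → Fin (Nat.factorial Φ.length) × Bool

/-- `σ^{(t)}`: the WalkSAT assignment after `t` steps, starting from the all-true
assignment, for the realization `ω` of the random seeds.  After `100 n²` steps, or
once `Φ` is satisfied, the assignment no longer changes. -/
def wsState {V : Type} [Fintype V] [DecidableEq V] (Φ : CNF V) (ω : wsSeedSpace V Φ) :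
    ℕ → (V → Bool)
  | 0 => fun _ => true
  | t + 1 =>
    if h : t < 100 * (Fintype.card V) ^ 2 then
      wsNext Φ (((ω ⟨t, h⟩).1 : ℕ), (ω ⟨t, h⟩).2) (wsState Φ ω t)
    else wsState Φ ω t

/-- `T(Φ)`: the total number of flips WalkSAT performs, i.e. the first time the
current assignment satisfies `Φ` (capped at the time limit `100 n²`). -/
noncomputable def wsT {V : Type} [Fintype V] [DecidableEq V] (Φ : CNF V)
    (ω : wsSeedSpace V Φ) : ℕ :=
  sInf ({t | cnfSat (wsState Φ ω t) Φ} ∪ {100 * (Fintype.card V) ^ 2})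

/-- `N(Φ, l)`: the total number of times WalkSAT flips variables from `𝒱(Φ,{l})`. -/
noncomputable def wsN {V : Type} [Fintype V] [DecidableEq V] (Φ : CNF V)
    (ω : wsSeedSpace V Φ) (l : Lit V) : ℕ :=
  ∑ v ∈ (Set.toFinite (ucpVars Φ l)).toFinset,
    ∑ t ∈ Finset.Icc 1 (wsT Φ ω),
      if wsState Φ ω (t - 1) v ≠ wsState Φ ω t v then 1 else 0

/-- Expectation over the random choices of WalkSAT (uniform over all seeds). -/
noncomputable def wsExp {V : Type} [Fintype V] [DecidableEq V] (Φ : CNF V)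
    (g : wsSeedSpace V Φ → ℝ) : ℝ :=
  (∑ ω : wsSeedSpace V Φ, g ω) / (Fintype.card (wsSeedSpace V Φ) : ℝ)

/-! ### The random formula `Φ_{n,m}` -/

/-- A sample point for the random 2-CNF: an ordered tuple of `m` clauses on the
variables `x₁, …, xₙ`. -/
abbrev FSpace (n m : ℕ) : Type := Fin m → Clause (Fin n)

/-- The 2-CNF corresponding to a sample point. -/
def toCNF {n m : ℕ} (f : FSpace n m) : CNF (Fin n) := List.ofFn f

/-- The set of proper sample points: each of the `m` clauses is one of the
`4n(n-1)` 2-clauses on two distinct variables.  The uniform distribution on this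
finite set is exactly the distribution of `Φ_{n,m}` (m independent uniform clauses). -/
noncomputable def validFormulas (n m : ℕ) : Finset (FSpace n m) :=
  Finset.univ.filter fun f => ∀ i, (f i).1.2 ≠ (f i).2.2

/-- Probability of an event under the random 2-CNF `Φ_{n,m}`. -/
noncomputable def prF (n m : ℕ) (P : FSpace n m → Prop) : ℝ :=
  (((validFormulas n m).filter fun f => P f).card : ℝ) / ((validFormulas n m).card : ℝ)

/-- Expectation of a functional of the random 2-CNF `Φ_{n,m}`. -/
noncomputable def expF (n m : ℕ) (g : FSpace n m → ℝ) : ℝ :=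
  (∑ f ∈ validFormulas n m, g f) / ((validFormulas n m).card : ℝ)

/-- `X(Φ) = Σ_x (|𝒱(Φ,{x})|² + |𝒱(Φ,{¬x})|²)`. -/
noncomputable def Xval (n : ℕ) (Φ : CNF (Fin n)) : ℝ :=
  ∑ x : Fin n,
    (((ucpVars Φ (true, x)).ncard : ℝ) ^ 2 + ((ucpVars Φ (false, x)).ncard : ℝ) ^ 2)

/-- `Y(Φ) = Σ_x min{|𝒱(Φ,{x})|² + |𝒱(Φ,{¬x})|², log⁴ n}`, the truncated version of `X(Φ)`. -/
noncomputable def Yval (n : ℕ) (Φ : CNF (Fin n)) : ℝ :=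
  ∑ x : Fin n,
    min (((ucpVars Φ (true, x)).ncard : ℝ) ^ 2 + ((ucpVars Φ (false, x)).ncard : ℝ) ^ 2)
      ((Real.log n) ^ 4)

namespace TwoSat

open scoped BigOperators
open Finset

/-! ### Averages over finite product spaces -/

section Product

variable {ι α : Type*} [Fintype ι] [Fintype α]

lemma expect_update [DecidableEq ι] [Nonempty α] (i : ι) (F : (ι → α) → ℝ) :
    𝔼 f, F f = 𝔼 f, 𝔼 c, F (Function.update f i c) := by
  have h : 𝔼 p : (ι → α) × α, F (Function.update p.1 i p.2) = 𝔼 p : (ι → α) × α, F p.1 :=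
    Fintype.expect_equiv
      (Function.Involutive.toPerm (fun p : (ι → α) × α => (Function.update p.1 i p.2, p.1 i))
        (fun p => by simp)) _ _ (fun p => rfl)
  rw [← univ_product_univ, expect_product, expect_product] at h
  simpa using h.symm

lemma exp_le_self_add_exp_sq {y : ℝ} (hy : |y| ≤ 1) : Real.exp y ≤ y + Real.exp (y ^ 2) := by
  have h1 := (abs_le.1 (Real.abs_exp_sub_one_sub_id_le hy)).2
  have h2 := Real.add_one_le_exp (y ^ 2)
  linarith

lemma expect_exp_mul_le [Nonempty α] (G : α → ℝ) {κ t : ℝ} (ht : 0 ≤ t) (htκ : t * κ ≤ 1)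
    (hG : ∀ a b, G a ≤ G b + κ) :
    𝔼 a, Real.exp (t * G a) ≤ Real.exp (t * (𝔼 a, G a) + (t * κ) ^ 2) := by
  set μ := 𝔼 a, G a
  have hκ : 0 ≤ κ := by
    obtain ⟨a⟩ := ‹Nonempty α›
    linarith [hG a a]
  have hdev : ∀ a, |t * (G a - μ)| ≤ t * κ := by
    intro a
    rw [abs_mul, abs_of_nonneg ht]
    refine mul_le_mul_of_nonneg_left (abs_le.2 ⟨?_, ?_⟩) ht
    · have : μ ≤ G a + κ := expect_le univ_nonempty fun b _ => hG b a
      linarith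
    · have : G a - κ ≤ μ := le_expect univ_nonempty fun b _ => by linarith [hG a b]
      linarith
  have hle : ∀ a, Real.exp (t * (G a - μ)) ≤ t * (G a - μ) + Real.exp ((t * κ) ^ 2) := fun a =>
    (exp_le_self_add_exp_sq ((hdev a).trans htκ)).trans <| by
      have := sq_le_sq' (abs_le.1 (hdev a)).1 (abs_le.1 (hdev a)).2
      gcongr
  have hmean : 𝔼 a, Real.exp (t * (G a - μ)) ≤ Real.exp ((t * κ) ^ 2) := by
    refine (expect_le_expect fun a _ => hle a).trans_eq ?_
    rw [expect_add_distrib, ← mul_expect, expect_sub_distrib, Fintype.expect_const,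
      Fintype.expect_const]
    simp [μ]
  calc 𝔼 a, Real.exp (t * G a) = 𝔼 a, Real.exp (t * μ) * Real.exp (t * (G a - μ)) :=
        expect_congr rfl fun a _ => by rw [← Real.exp_add]; ring_nf
    _ = Real.exp (t * μ) * 𝔼 a, Real.exp (t * (G a - μ)) :=
        (mul_expect _ _ _).symm
    _ ≤ Real.exp (t * μ) * Real.exp ((t * κ) ^ 2) := by gcongr
    _ = _ := by rw [← Real.exp_add]

lemma expect_fin_cons [Nonempty α] {m : ℕ} (F : (Fin (m + 1) → α) → ℝ) :
    𝔼 f, F f = 𝔼 c, 𝔼 g : Fin m → α, F (Fin.cons c g) := by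
  rw [← expect_product', univ_product_univ]
  exact (Fintype.expect_equiv (Fin.consEquiv fun _ => α) _ _ fun p => rfl).symm

/-- Moment generating function bound for functions with bounded differences. -/
lemma expect_exp_le_of_bounded_differences [Nonempty α] {κ t : ℝ} (ht : 0 ≤ t)
    (htκ : t * κ ≤ 1) (m : ℕ) (F : (Fin m → α) → ℝ)
    (hF : ∀ f g i, (∀ j, j ≠ i → f j = g j) → F f ≤ F g + κ) :
    𝔼 f, Real.exp (t * F f) ≤ Real.exp (t * (𝔼 f, F f) + m * (t * κ) ^ 2) := by
  induction m with
  | zero =>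
    have h0 : ∀ H : (Fin 0 → α) → ℝ, 𝔼 f, H f = H finZeroElim := fun H => by
      rw [Fintype.expect_eq_sum_div_card]
      simp [Subsingleton.elim (default : Fin 0 → α) finZeroElim]
    rw [h0, h0]
    simp
  | succ m ih =>
    rw [expect_fin_cons, expect_fin_cons]
    set G : α → ℝ := fun c => 𝔼 g : Fin m → α, F (Fin.cons c g)
    have hG : ∀ a b, G a ≤ G b + κ := fun a b => by
      have : G b + κ = 𝔼 g : Fin m → α, (F (Fin.cons b g) + κ) := by
        rw [expect_add_distrib, Fintype.expect_const]
      rw [this]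
      refine expect_le_expect fun g _ => hF _ _ 0 fun j hj => ?_
      obtain ⟨j, rfl⟩ := Fin.exists_succ_eq.2 hj
      simp
    have hstep : ∀ c, 𝔼 g : Fin m → α, Real.exp (t * F (Fin.cons c g)) ≤
        Real.exp (m * (t * κ) ^ 2) * Real.exp (t * G c) := fun c => by
      rw [← Real.exp_add, add_comm ((m : ℝ) * _)]
      refine ih (fun g => F (Fin.cons c g)) fun f g i h => hF _ _ i.succ fun j hj => ?_
      cases j using Fin.cases with
      | zero => simp
      | succ j => simpa using h j fun h => hj (h ▸ rfl)
    refine (expect_le_expect fun c _ => hstep c).trans ?_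
    rw [← mul_expect]
    refine (mul_le_mul_of_nonneg_left (expect_exp_mul_le G ht htκ hG)
      (Real.exp_pos _).le).trans_eq ?_
    rw [← Real.exp_add]
    push_cast
    ring_nf

/-- Union bound. -/
lemma expect_indicator_mono {Ω : Type*} [Fintype Ω] {P Q R : Ω → Prop}
    (h : ∀ ω, P ω → Q ω ∨ R ω) :
    𝔼 ω, (if P ω then (1 : ℝ) else 0) ≤
      𝔼 ω, (if Q ω then (1 : ℝ) else 0) + 𝔼 ω, (if R ω then (1 : ℝ) else 0) := by
  rw [← expect_add_distrib]
  refine expect_le_expect fun ω _ => ?_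
  have := h ω
  by_cases hP : P ω <;> by_cases hQ : Q ω <;> by_cases hR : R ω <;> simp_all

lemma tail_le_of_bounded_differences [Nonempty α] {κ t a : ℝ} (ht : 0 ≤ t)
    (htκ : t * κ ≤ 1) (m : ℕ) (F : (Fin m → α) → ℝ)
    (hF : ∀ f g i, (∀ j, j ≠ i → f j = g j) → F f ≤ F g + κ) :
    𝔼 f, (if (𝔼 g, F g) + a ≤ F f then (1 : ℝ) else 0) ≤
      Real.exp (m * (t * κ) ^ 2 - t * a) := by
  set μ := 𝔼 g, F g
  have h1 : ∀ f, (if μ + a ≤ F f then (1 : ℝ) else 0) ≤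
      Real.exp (-(t * (μ + a))) * Real.exp (t * F f) := fun f => by
    rw [← Real.exp_add]
    split_ifs with h
    · exact Real.one_le_exp (by nlinarith)
    · exact (Real.exp_pos _).le
  refine (expect_le_expect fun f _ => h1 f).trans ?_
  rw [← mul_expect]
  refine (mul_le_mul_of_nonneg_left (expect_exp_le_of_bounded_differences ht htκ m F hF)
      (Real.exp_pos _).le).trans_eq ?_
  rw [← Real.exp_add]
  congr 1
  ring

end Product

/-! ### Walks in the implication digraph -/

section Walk

variable {ι V : Type}

@[simp] lemma negate_negate (l : Lit V) : l.negate.negate = l := by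
  simp [Lit.negate]

@[simp] lemma negate_snd (l : Lit V) : l.negate.2 = l.2 := rfl

/-- The clause `c` reads `¬u ∨ v`, up to the order of its literals. -/
def Arc (c : Clause V) (u v : Lit V) : Prop :=
  (c.1 = u.negate ∧ c.2 = v) ∨ (c.2 = u.negate ∧ c.1 = v)

lemma Arc.contrapose {c : Clause V} {u v : Lit V} (h : Arc c u v) : Arc c v.negate u.negate := by
  rcases h with ⟨h1, h2⟩ | ⟨h1, h2⟩
  · exact Or.inr ⟨by simpa using h2, h1⟩
  · exact Or.inl ⟨by simpa using h2, h1⟩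

/-- A clause gives rise to just one pair of contrapositive arcs. -/
lemma Arc.eq_or {c : Clause V} {u v w z : Lit V} (h : Arc c u v) (h' : Arc c w z) :
    (w = u ∧ z = v) ∨ (w = v.negate ∧ z = u.negate) := by
  rcases h with ⟨h1, h2⟩ | ⟨h1, h2⟩ <;> rcases h' with ⟨h3, h4⟩ | ⟨h3, h4⟩
  · exact Or.inl ⟨by rw [← negate_negate w, ← h3, h1, negate_negate], by rw [← h4, h2]⟩
  · exact Or.inr ⟨by rw [← h2, h3, negate_negate], by rw [← h4, h1]⟩
  · exact Or.inr ⟨by rw [← h2, h3, negate_negate], by rw [← h4, h1]⟩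
  · exact Or.inl ⟨by rw [← negate_negate w, ← h3, h1, negate_negate], by rw [← h4, h2]⟩

/-- `JumpWalk f I S u a w`: the literal `w` can be reached from `u` by traversing `a` arcs of
clauses with indices outside `I`, where additionally a walk arriving in `S` may continue
from any other member of `S`. -/
inductive JumpWalk (f : ι → Clause V) (I : Finset ι) (S : Finset (Lit V)) (u : Lit V) :
    ℕ → Lit V → Prop
  | refl : JumpWalk f I S u 0 u
  | step {a : ℕ} {w z : Lit V} {i : ι} :
      JumpWalk f I S u a w → i ∉ I → Arc (f i) w z → JumpWalk f I S u (a + 1) z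
  | jump {a : ℕ} {w z : Lit V} :
      JumpWalk f I S u (a + 1) w → w ∈ S → z ∈ S → JumpWalk f I S u (a + 1) z

namespace JumpWalk

variable {f g : ι → Clause V} {I J : Finset ι} {S T : Finset (Lit V)} {u v w z : Lit V} {a b : ℕ}

lemma mono (h : JumpWalk f I S u a w) (hJ : J ⊆ I) (hT : S ⊆ T) : JumpWalk f J T u a w := by
  induction h with
  | refl => exact refl
  | step _ hi h ih => exact ih.step (fun h => hi (hJ h)) h
  | jump _ hw hz ih => exact ih.jump (hT hw) (hT hz)

lemma congr (h : JumpWalk f I S u a w) (hfg : ∀ i ∉ I, f i = g i) : JumpWalk g I S u a w := by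
  induction h with
  | refl => exact refl
  | step _ hi h ih => exact ih.step hi (hfg _ hi ▸ h)
  | jump _ hw hz ih => exact ih.jump hw hz

lemma congr_iff (hfg : ∀ i ∉ I, f i = g i) : JumpWalk f I S u a w ↔ JumpWalk g I S u a w :=
  ⟨fun h => h.congr hfg, fun h => h.congr fun i hi => (hfg i hi).symm⟩

lemma eq_start_of_zero (h : JumpWalk f I S u 0 w) : w = u := by
  cases h; rfl

lemma start_or_jump (h : JumpWalk f I S u a w) (hw : w ∈ S) (hz : z ∈ S) :
    w = u ∨ JumpWalk f I S u a z := by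
  cases a with
  | zero => exact Or.inl h.eq_start_of_zero
  | succ a => exact Or.inr (h.jump hw hz)

lemma trans (h : JumpWalk f I ∅ u a v) (h' : JumpWalk f I ∅ v b w) :
    JumpWalk f I ∅ u (a + b) w := by
  induction h' with
  | refl => exact h
  | step _ hi harc ih => exact ih.step hi harc
  | jump _ hw => simp at hw

lemma contrapose (h : JumpWalk f I ∅ u a v) : JumpWalk f I ∅ v.negate a u.negate := by
  induction h with
  | refl => exact refl
  | @step a w z i _ hi harc ih =>
    have := (refl.step hi harc.contrapose).trans ih
    rwa [Nat.zero_add, Nat.add_comm] at this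
  | jump _ hw => simp at hw

variable [DecidableEq ι] [DecidableEq V]

/-- Splitting off the first arc of a walk.  The clause of this arc is never needed again,
except for its contrapositive, whose use requires the walk to hit its own negation. -/
lemma first_step (h : JumpWalk f I S u a w) (hu : u.negate ∈ S) :
    (a = 0 ∧ w = u) ∨ ∃ i ∉ I, ∃ v, Arc (f i) u v ∧ ∃ b < a,
      (JumpWalk f (insert i I) (insert v (insert v.negate S)) v b w ∨
        v ∈ S ∧ ∃ s ∈ S, JumpWalk f (insert i I) (insert v (insert v.negate S)) s b w) := by
  induction h with
  | refl => exact Or.inl ⟨rfl, rfl⟩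
  | @step a w z i _ hi harc ih =>
    right
    rcases ih with ⟨rfl, rfl⟩ | ⟨j, hj, v, hv, b, hb, hw⟩
    · exact ⟨i, hi, z, harc, 0, by omega, Or.inl refl⟩
    refine ⟨j, hj, v, hv, ?_⟩
    by_cases hij : i = j
    · subst hij
      rcases hv.eq_or harc with ⟨rfl, rfl⟩ | ⟨rfl, rfl⟩
      · exact ⟨0, by omega, Or.inl refl⟩
      · have hmem : v.negate ∈ insert v (insert v.negate S) := by simp
        have hmem' : u.negate ∈ insert v (insert v.negate S) := by simp [hu]
        rcases hw with hw | ⟨hvS, s, hs, hw⟩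
        · rcases hw.start_or_jump hmem hmem' with h | h
          · simp [Lit.negate, Prod.ext_iff] at h
          · exact ⟨b, by omega, Or.inl h⟩
        · rcases hw.start_or_jump hmem hmem' with h | h
          · exact ⟨0, by omega, Or.inr ⟨hvS, _, hu, refl⟩⟩
          · exact ⟨b, by omega, Or.inr ⟨hvS, s, hs, h⟩⟩
    · have hi' : i ∉ insert j I := by simp [hij, hi]
      refine ⟨b + 1, by omega, ?_⟩
      rcases hw with hw | ⟨hvS, s, hs, hw⟩
      · exact Or.inl (hw.step hi' harc)
      · exact Or.inr ⟨hvS, s, hs, hw.step hi' harc⟩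
  | @jump a w z _ hw hz ih =>
    rcases ih with ⟨h, -⟩ | ⟨j, hj, v, hv, b, hb, hw'⟩
    · omega
    right
    refine ⟨j, hj, v, hv, ?_⟩
    have hmem : w ∈ insert v (insert v.negate S) := by simp [hw]
    have hmem' : z ∈ insert v (insert v.negate S) := by simp [hz]
    rcases hw' with hw' | ⟨hvS, s, hs, hw'⟩
    · rcases hw'.start_or_jump hmem hmem' with rfl | h
      · exact ⟨0, by omega, Or.inr ⟨hw, z, hz, refl⟩⟩
      · exact ⟨b, by omega, Or.inl h⟩
    · rcases hw'.start_or_jump hmem hmem' with h | h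
      · exact ⟨0, by omega, Or.inr ⟨hvS, z, hz, refl⟩⟩
      · exact ⟨b, by omega, Or.inr ⟨hvS, s, hs, h⟩⟩

omit [DecidableEq V] in
/-- Walks avoiding `I` can be restarted from the literals of the clause of their last use of the
index `i`. -/
lemma avoid (h : JumpWalk f I ∅ u a w) (i : ι) :
    JumpWalk f (insert i I) ∅ u a w ∨
      ∃ b ≤ a, JumpWalk f (insert i I) ∅ (f i).1 b w ∨ JumpWalk f (insert i I) ∅ (f i).2 b w := by
  induction h with
  | refl => exact Or.inl refl
  | @step a w z j _ hj harc ih =>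
    by_cases hij : j = i
    · subst hij
      right
      rcases harc with ⟨-, rfl⟩ | ⟨-, rfl⟩
      · exact ⟨0, by omega, Or.inr refl⟩
      · exact ⟨0, by omega, Or.inl refl⟩
    · have hj' : j ∉ insert i I := by simp [hij, hj]
      rcases ih with h | ⟨b, hb, h | h⟩
      · exact Or.inl (h.step hj' harc)
      · exact Or.inr ⟨b + 1, by omega, Or.inl (h.step hj' harc)⟩
      · exact Or.inr ⟨b + 1, by omega, Or.inr (h.step hj' harc)⟩
  | jump _ hw => simp at hw

end JumpWalk

end Walk


/-! ### Moments of the number of literals reachable by short walks -/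

section Moments

variable {ι V : Type} [Fintype V]

/-- The clauses on two distinct variables. -/
abbrev ProperClause (V : Type) := {c : Clause V // c.1.2 ≠ c.2.2}

/-- The literals at the ends of jump walks with at most `j` arcs starting from `u`. -/
noncomputable def jumpReach (j : ℕ) (f : ι → ProperClause V) (I : Finset ι) (S : Finset (Lit V))
    (u : Lit V) : Finset (Lit V) :=
  univ.filter fun w => ∃ a ≤ j, JumpWalk (fun i => (f i : Clause V)) I S u a w

/-- The literals reachable from `B` by walks with at most `ℓ` arcs. -/
noncomputable def reach (ℓ : ℕ) (f : ι → ProperClause V) (I : Finset ι) (B : Finset (Lit V)) :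
    Finset (Lit V) :=
  univ.filter fun w => ∃ u ∈ B, ∃ a ≤ ℓ, JumpWalk (fun i => (f i : Clause V)) I ∅ u a w

lemma jumpReach_congr {j : ℕ} {f g : ι → ProperClause V} {I : Finset ι} {S : Finset (Lit V)}
    {u : Lit V} (h : ∀ i ∉ I, f i = g i) : jumpReach j f I S u = jumpReach j g I S u := by
  ext w
  simp only [jumpReach, mem_filter, mem_univ, true_and]
  exact exists_congr fun a => and_congr_right fun _ =>
    JumpWalk.congr_iff fun i hi => congrArg Subtype.val (h i hi)

lemma reach_congr {ℓ : ℕ} {f g : ι → ProperClause V} {I : Finset ι} {B : Finset (Lit V)}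
    (h : ∀ i ∉ I, f i = g i) : reach ℓ f I B = reach ℓ g I B := by
  ext w
  simp only [reach, mem_filter, mem_univ, true_and]
  exact exists_congr fun u => and_congr_right fun _ => exists_congr fun a =>
    and_congr_right fun _ => JumpWalk.congr_iff fun i hi => congrArg Subtype.val (h i hi)

lemma jumpReach_zero (f : ι → ProperClause V) (I : Finset ι) (S : Finset (Lit V)) (u : Lit V) :
    jumpReach 0 f I S u = {u} := by
  ext w
  simp only [jumpReach, Nat.le_zero, mem_filter, mem_univ, true_and, exists_eq_left, mem_singleton]
  exact ⟨JumpWalk.eq_start_of_zero, fun h => h ▸ .refl⟩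

lemma card_properClause [DecidableEq V] :
    Fintype.card (ProperClause V) = 4 * (Fintype.card V * (Fintype.card V - 1)) := by
  have e : ProperClause V ≃ (Bool × Bool) × {p : V × V // p ∈ (univ : Finset V).offDiag} :=
    { toFun := fun c => ((c.1.1.1, c.1.2.1), ⟨(c.1.1.2, c.1.2.2), by simpa using c.2⟩)
      invFun := fun p => ⟨((p.1.1, p.2.1.1), (p.1.2, p.2.1.2)), (mem_offDiag.1 p.2.2).2.2⟩
      left_inv := fun c => rfl
      right_inv := fun p => rfl }
  rw [Fintype.card_congr e, Fintype.card_prod, Fintype.card_coe, offDiag_card]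
  simp [Nat.mul_sub]

lemma nonempty_properClause [DecidableEq V] (hV : 2 ≤ Fintype.card V) :
    Nonempty (ProperClause V) := by
  rw [← Fintype.card_pos_iff, card_properClause]
  have : 0 < Fintype.card V - 1 := by omega
  positivity

lemma expect_arc_le [DecidableEq V] (hV : 2 ≤ Fintype.card V) (u v : Lit V) :
    𝔼 c : ProperClause V, (if Arc (c : Clause V) u v then (1 : ℝ) else 0) ≤
      if v.2 ≠ u.2 then 1 / (2 * ((Fintype.card V : ℝ) * (Fintype.card V - 1))) else 0 := by
  have hcard : (Fintype.card (ProperClause V) : ℝ) =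
      4 * (Fintype.card V * (Fintype.card V - 1)) := by
    rw [card_properClause]
    push_cast [Nat.cast_sub (by omega : 1 ≤ Fintype.card V)]
    ring
  split_ifs with h
  · rw [Fintype.expect_eq_sum_div_card, hcard, sum_boole]
    have h2 : (univ.filter fun c : ProperClause V => Arc (c : Clause V) u v).card ≤ 2 := by
      rw [← card_map (Function.Embedding.subtype _)]
      refine (card_le_card (t := {(u.negate, v), (v, u.negate)}) ?_).trans card_le_two
      intro c hc
      simp only [Finset.mem_map, mem_filter, mem_univ, true_and, Function.Embedding.subtype_apply] at hc
      obtain ⟨c, ⟨h1, h2⟩ | ⟨h1, h2⟩, rfl⟩ := hc <;> simp [Prod.ext_iff, ← h1, ← h2]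
    have hpos : (0 : ℝ) < Fintype.card V * (Fintype.card V - 1) := by
      have : (2 : ℝ) ≤ Fintype.card V := by exact_mod_cast hV
      exact mul_pos (by linarith) (by linarith)
    rw [div_le_div_iff₀ (by linarith) (by linarith)]
    have : ((univ.filter fun c : ProperClause V => Arc (c : Clause V) u v).card : ℝ) ≤ 2 := by
      exact_mod_cast h2
    nlinarith
  · refine (expect_congr rfl fun c _ => if_neg ?_).trans_le (by simp)
    rintro (⟨h1, h2⟩ | ⟨h1, h2⟩) <;> have := c.2 <;> simp_all

variable [DecidableEq V]

lemma reach_subset_biUnion (ℓ : ℕ) (f : ι → ProperClause V) (I : Finset ι) (B : Finset (Lit V)) :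
    reach ℓ f I B ⊆ B.biUnion fun u => jumpReach ℓ f I {u, u.negate} u := by
  intro w hw
  simp only [reach, mem_filter, mem_univ, true_and] at hw
  obtain ⟨u, hu, a, ha, h⟩ := hw
  simp only [mem_biUnion, jumpReach, mem_filter, mem_univ, true_and]
  exact ⟨u, hu, a, ha, h.mono (Subset.refl _) (empty_subset _)⟩

variable [DecidableEq ι]

lemma reach_subset_of_arc {ℓ : ℕ} {f : ι → ProperClause V} {I : Finset ι} {B : Finset (Lit V)}
    {i : ι} {u v : Lit V} (h : Arc (f i : Clause V) u v) :
    reach ℓ f I B ⊆ reach ℓ f (insert i I) (insert u.negate (insert v B)) := by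
  intro w hw
  simp only [reach, mem_filter, mem_univ, true_and, mem_insert] at hw ⊢
  obtain ⟨s, hs, a, ha, hw⟩ := hw
  rcases hw.avoid i with hw | ⟨b, hb, hw⟩
  · exact ⟨s, .inr (.inr hs), a, ha, hw⟩
  · rcases h with ⟨h1, h2⟩ | ⟨h1, h2⟩ <;> simp only [h1, h2] at hw <;> rcases hw with hw | hw
    · exact ⟨_, .inl rfl, b, hb.trans ha, hw⟩
    · exact ⟨_, .inr (.inl rfl), b, hb.trans ha, hw⟩
    · exact ⟨_, .inr (.inl rfl), b, hb.trans ha, hw⟩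
    · exact ⟨_, .inl rfl, b, hb.trans ha, hw⟩

variable [Fintype ι]

lemma card_jumpReach_succ_le (j : ℕ) (f : ι → ProperClause V) (I : Finset ι) (S : Finset (Lit V))
    (u : Lit V) (hu : u.negate ∈ S) :
    (jumpReach (j + 1) f I S u).card ≤ 1 + ∑ i ∈ Iᶜ, ∑ v, if Arc (f i : Clause V) u v then
      (jumpReach j f (insert i I) (insert v (insert v.negate S)) v).card +
        (if v ∈ S then
          ∑ s ∈ S, (jumpReach j f (insert i I) (insert v (insert v.negate S)) s).card else 0)
      else 0 := by
  have hsub : jumpReach (j + 1) f I S u ⊆ {u} ∪ Iᶜ.biUnion fun i => univ.biUnion fun v =>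
      if Arc (f i : Clause V) u v then
        jumpReach j f (insert i I) (insert v (insert v.negate S)) v ∪
          (if v ∈ S then
            S.biUnion fun s => jumpReach j f (insert i I) (insert v (insert v.negate S)) s else ∅)
      else ∅ := by
    intro w hw
    simp only [jumpReach, mem_filter, mem_univ, true_and] at hw
    obtain ⟨a, ha, hw⟩ := hw
    rcases hw.first_step hu with ⟨-, rfl⟩ | ⟨i, hi, v, hv, b, hb, hw⟩
    · simp
    · refine mem_union_right _
        (mem_biUnion.2 ⟨i, by simpa using hi, mem_biUnion.2 ⟨v, mem_univ _, ?_⟩⟩)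
      rw [if_pos hv]
      rcases hw with hw | ⟨hvS, s, hs, hw⟩
      · exact mem_union_left _ (mem_filter.2 ⟨mem_univ _, b, by omega, hw⟩)
      · rw [if_pos hvS]
        exact mem_union_right _
          (mem_biUnion.2 ⟨s, hs, mem_filter.2 ⟨mem_univ _, b, by omega, hw⟩⟩)
  refine (card_le_card hsub).trans ((card_union_le _ _).trans (Nat.add_le_add (by simp) ?_))
  refine card_biUnion_le.trans (sum_le_sum fun i _ => card_biUnion_le.trans
    (sum_le_sum fun v _ => ?_))
  split_ifs
  · exact (card_union_le _ _).trans (Nat.add_le_add_left card_biUnion_le _)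
  · simp
  · simp

omit [Fintype V] [DecidableEq V] in
/-- A coordinate is independent of the functions not depending on it. -/
lemma expect_ite_mul {α : Type} [Fintype α] [Nonempty α] (i : ι) (P : α → Prop)
    (H : (ι → α) → ℝ) (hH : ∀ f c, H (Function.update f i c) = H f) :
    𝔼 f : ι → α, (if P (f i) then H f else 0) = (𝔼 c, if P c then (1 : ℝ) else 0) * 𝔼 f, H f := by
  rw [expect_update i, mul_expect]
  refine expect_congr rfl fun f _ => ?_
  simp only [Function.update_self, hH]
  rw [expect_mul]
  exact expect_congr rfl fun c _ => by split_ifs <;> simp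


omit [DecidableEq ι] [Fintype ι] in
lemma sum_arc_weight_le (hV : 2 ≤ Fintype.card V) (S : Finset (Lit V)) (u : Lit V) :
    ∑ v : Lit V,
      (if v.2 ≠ u.2 then 1 / (2 * ((Fintype.card V : ℝ) * (Fintype.card V - 1))) else 0) *
        (1 + if v ∈ S then (S.card : ℝ) else 0) ≤
    (1 + (S.card : ℝ) ^ 2 / (2 * (Fintype.card V - 1))) / Fintype.card V := by
  have hN : (2 : ℝ) ≤ Fintype.card V := by exact_mod_cast hV
  set N := (Fintype.card V : ℝ)
  have hN1 : 0 < N - 1 := by linarith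
  have hcount : ∑ v : Lit V, (if v.2 ≠ u.2 then (1 : ℝ) else 0) = 2 * (N - 1) := by
    rw [Fintype.sum_prod_type]
    simp only [Fintype.sum_bool, sum_boole, ne_eq]
    rw [filter_ne', card_erase_of_mem (mem_univ _), card_univ, Nat.cast_sub (by omega)]
    simp only [N, Nat.cast_one]
    ring
  have hpos : 0 ≤ 1 / (2 * (N * (N - 1))) := by positivity
  calc _ ≤ ∑ v : Lit V, 1 / (2 * (N * (N - 1))) *
          ((if v.2 ≠ u.2 then (1 : ℝ) else 0) + if v ∈ S then (S.card : ℝ) else 0) := by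
        refine sum_le_sum fun v _ => ?_
        split_ifs <;> simp only [zero_mul, add_zero, zero_add, mul_zero, le_refl]
        positivity
    _ = 1 / (2 * (N * (N - 1))) * (2 * (N - 1) + (S.card : ℝ) * S.card) := by
        rw [← mul_sum, sum_add_distrib, hcount, sum_ite_mem, univ_inter, sum_const, nsmul_eq_mul]
    _ = _ := by field_simp

set_option maxHeartbeats 1000000 in
/-- The recursion on the number of arcs behind the moment bound: as long as the number of clauses
is subcritical, a walk acquires at most one new literal per arc on average. -/
lemma expect_jumpReach_mul_le {ℓ k : ℕ} {C : ℕ → ℝ} (hC : Monotone C) (hC0 : ∀ b, 0 ≤ C b)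
    (hV : 2 ≤ Fintype.card V)
    (hsub : Fintype.card ι * (1 + (2 * ℓ + 2 : ℝ) ^ 2 / (2 * (Fintype.card V - 1))) ≤
      Fintype.card V)
    (hD : ∀ (I : Finset ι) (B : Finset (Lit V)),
      𝔼 f : ι → ProperClause V, ((reach ℓ f I B).card : ℝ) ^ k ≤ C B.card)
    (j : ℕ) (I : Finset ι) (S B : Finset (Lit V)) (u : Lit V)
    (hS : ∀ l ∈ S, l.negate ∈ S) (hu : u.negate ∈ S) (hj : S.card + 2 * j ≤ 2 * ℓ + 2) :
    𝔼 f : ι → ProperClause V, ((jumpReach j f I S u).card : ℝ) * ((reach ℓ f I B).card : ℝ) ^ k ≤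
      (j + 1) * C (B.card + 2 * j) := by
  induction j generalizing I S B u with
  | zero => simpa [jumpReach_zero] using hD I B
  | succ j ih =>
    have hN : (2 : ℝ) ≤ Fintype.card V := by exact_mod_cast hV
    have := nonempty_properClause hV
    set M : ℝ := (j + 1) * C (B.card + 2 * (j + 1))
    have hM : 0 ≤ M := mul_nonneg (by positivity) (hC0 _)
    let S' : Lit V → Finset (Lit V) := fun v => insert v (insert v.negate S)
    let H : ι → Lit V → (ι → ProperClause V) → ℝ := fun i v f =>
      (((jumpReach j f (insert i I) (S' v) v).card : ℝ) +
        if v ∈ S then ∑ s ∈ S, ((jumpReach j f (insert i I) (S' v) s).card : ℝ) else 0) *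
      ((reach ℓ f (insert i I) (insert u.negate (insert v B))).card : ℝ) ^ k
    have hpt : ∀ f : ι → ProperClause V,
        ((jumpReach (j + 1) f I S u).card : ℝ) * ((reach ℓ f I B).card : ℝ) ^ k ≤
        ((reach ℓ f I B).card : ℝ) ^ k +
          ∑ i ∈ Iᶜ, ∑ v, if Arc (f i : Clause V) u v then H i v f else 0 := fun f => by
      have h1 : ((jumpReach (j + 1) f I S u).card : ℝ) ≤ _ :=
        Nat.cast_le.2 (card_jumpReach_succ_le j f I S u hu)
      push_cast at h1
      refine (mul_le_mul_of_nonneg_right h1 (by positivity)).trans ?_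
      rw [add_mul, one_mul, sum_mul]
      refine add_le_add_right (sum_le_sum fun i _ => ?_) _
      rw [sum_mul]
      refine sum_le_sum fun v _ => ?_
      rw [ite_mul, zero_mul]
      split_ifs with h2 h3
      all_goals first | exact le_rfl | skip
      all_goals
        simp only [H, S', h3, if_true, if_false]
        gcongr
        exact reach_subset_of_arc h2
    have hS' : ∀ v, ∀ l ∈ S' v, l.negate ∈ S' v := by
      intro v l hl
      simp only [S', mem_insert] at hl ⊢
      rcases hl with rfl | rfl | hl
      · simp
      · simp
      · exact .inr (.inr (hS l hl))
    have hcard : ∀ v, (S' v).card + 2 * j ≤ 2 * ℓ + 2 := fun v => by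
      have h1 := card_insert_le v (insert v.negate S)
      have h2 := card_insert_le v.negate S
      simp only [S']
      omega
    have hbound : ∀ i v s, s.negate ∈ S' v →
        𝔼 f : ι → ProperClause V, ((jumpReach j f (insert i I) (S' v) s).card : ℝ) *
          ((reach ℓ f (insert i I) (insert u.negate (insert v B))).card : ℝ) ^ k ≤ M := by
      intro i v s hs
      refine (ih _ _ (insert u.negate (insert v B)) _ (hS' v) hs (hcard v)).trans ?_
      refine mul_le_mul_of_nonneg_left (hC ?_) (by positivity)
      have h1 := card_insert_le u.negate (insert v B)
      have h2 := card_insert_le v B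
      omega
    have hEH : ∀ i v, 𝔼 f, H i v f ≤ (1 + if v ∈ S then (S.card : ℝ) else 0) * M := by
      intro i v
      simp only [H, add_mul, expect_add_distrib, one_mul]
      refine add_le_add (hbound i v v (by simp [S'])) ?_
      split_ifs
      · simp only [sum_mul]
        rw [expect_sum_comm, ← nsmul_eq_mul]
        exact sum_le_card_nsmul _ _ _ fun s hs => hbound i v s (by simp [S', hS s hs])
      · simp
    have hHnn : ∀ i v f, 0 ≤ H i v f := fun i v f => by
      refine mul_nonneg (add_nonneg (Nat.cast_nonneg _) ?_) (pow_nonneg (Nat.cast_nonneg _) _)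
      split_ifs
      exacts [sum_nonneg fun _ _ => Nat.cast_nonneg _, le_rfl]
    have hH : ∀ i v f c, H i v (Function.update f i c) = H i v f := by
      intro i v f c
      have hf : ∀ i' ∉ insert i I, Function.update f i c i' = f i' := fun i' hi' =>
        Function.update_of_ne (fun h => hi' (by simp [h])) _ _
      simp only [H, jumpReach_congr hf, reach_congr hf]
    calc 𝔼 f : ι → ProperClause V,
          ((jumpReach (j + 1) f I S u).card : ℝ) * ((reach ℓ f I B).card : ℝ) ^ k
        ≤ 𝔼 f : ι → ProperClause V, (((reach ℓ f I B).card : ℝ) ^ k +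
          ∑ i ∈ Iᶜ, ∑ v, if Arc (f i : Clause V) u v then H i v f else 0) :=
          expect_le_expect fun f _ => hpt f
      _ = 𝔼 f : ι → ProperClause V, ((reach ℓ f I B).card : ℝ) ^ k + ∑ i ∈ Iᶜ, ∑ v,
          (𝔼 c : ProperClause V, if Arc (c : Clause V) u v then (1 : ℝ) else 0) *
            𝔼 f, H i v f := by
          rw [expect_add_distrib, expect_sum_comm]
          congr 1
          refine sum_congr rfl fun i _ => ?_
          rw [expect_sum_comm]
          exact sum_congr rfl fun v _ =>
            expect_ite_mul i (fun c : ProperClause V => Arc (c : Clause V) u v) _ (hH i v)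
      _ ≤ C (B.card + 2 * (j + 1)) + ∑ i : ι, ∑ v : Lit V,
          (if v.2 ≠ u.2 then 1 / (2 * ((Fintype.card V : ℝ) * (Fintype.card V - 1))) else 0) *
            ((1 + if v ∈ S then (S.card : ℝ) else 0) * M) := by
          have hp : 0 ≤ 1 / (2 * ((Fintype.card V : ℝ) * (Fintype.card V - 1))) := by
            have : 0 ≤ (Fintype.card V : ℝ) - 1 := by linarith
            positivity
          have hnn : ∀ v : Lit V, 0 ≤ (if v.2 ≠ u.2 then
              1 / (2 * ((Fintype.card V : ℝ) * (Fintype.card V - 1))) else 0) := fun v => by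
            split_ifs <;> first | exact hp | exact le_rfl
          have hnn' : ∀ v : Lit V, 0 ≤ (1 + if v ∈ S then (S.card : ℝ) else 0) * M := fun v => by
            split_ifs <;> positivity
          refine add_le_add ((hD I B).trans (hC (by omega))) ?_
          refine (sum_le_sum fun i _ => sum_le_sum fun v _ => ?_).trans
            (sum_le_sum_of_subset_of_nonneg (subset_univ _) fun i _ _ =>
              sum_nonneg fun v _ => mul_nonneg (hnn v) (hnn' v))
          exact mul_le_mul (expect_arc_le hV u v) (hEH i v)
            (expect_nonneg fun f _ => hHnn i v f) (hnn v)
      _ ≤ C (B.card + 2 * (j + 1)) + M := by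
          refine add_le_add_right ?_ _
          rw [sum_const, nsmul_eq_mul, card_univ, sum_congr rfl fun v _ => (mul_assoc _ _ M).symm,
            ← sum_mul, ← mul_assoc]
          refine mul_le_of_le_one_left hM ?_
          refine (mul_le_mul_of_nonneg_left (sum_arc_weight_le hV S u) (Nat.cast_nonneg _)).trans ?_
          rw [← mul_div_assoc, div_le_one (by linarith)]
          refine le_trans ?_ hsub
          have hS2 : (S.card : ℝ) ≤ 2 * ℓ + 2 := by
            exact_mod_cast (by omega : S.card ≤ 2 * ℓ + 2)
          have : 0 < (Fintype.card V : ℝ) - 1 := by linarith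
          gcongr
      _ = _ := by
          simp only [M]
          push_cast
          ring

/-- In the subcritical regime, the number of literals reachable by short walks from a set `B` of
literals has moments comparable to those of a constant of size `|B|`, up to factors `ℓ`. -/
theorem expect_card_reach_pow_le {ℓ : ℕ} (hV : 2 ≤ Fintype.card V)
    (hsub : Fintype.card ι * (1 + (2 * ℓ + 2 : ℝ) ^ 2 / (2 * (Fintype.card V - 1))) ≤
      Fintype.card V)
    (k : ℕ) (I : Finset ι) (B : Finset (Lit V)) :
    𝔼 f : ι → ProperClause V, ((reach ℓ f I B).card : ℝ) ^ k ≤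
      ((B.card + 2 * k * ℓ) * (ℓ + 1)) ^ k := by
  induction k generalizing I B with
  | zero =>
    have := nonempty_properClause hV
    simp
  | succ k ih =>
    let C : ℕ → ℝ := fun b => (((b : ℝ) + 2 * k * ℓ) * (ℓ + 1)) ^ k
    have hC : Monotone C := fun a b h => by
      have : (a : ℝ) ≤ b := by exact_mod_cast h
      simp only [C]
      gcongr
    have hmain : ∀ u, 𝔼 f : ι → ProperClause V,
        ((jumpReach ℓ f I {u, u.negate} u).card : ℝ) * ((reach ℓ f I B).card : ℝ) ^ k ≤
          (ℓ + 1) * C (B.card + 2 * ℓ) := fun u => by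
      refine expect_jumpReach_mul_le hC (fun b => by positivity) hV hsub ih ℓ I _ B u ?_ ?_ ?_
      · intro l hl
        simp only [mem_insert, mem_singleton] at hl ⊢
        rcases hl with rfl | rfl <;> simp
      · simp
      · have := card_le_two (a := u) (b := u.negate)
        omega
    calc 𝔼 f : ι → ProperClause V, ((reach ℓ f I B).card : ℝ) ^ (k + 1)
        ≤ 𝔼 f : ι → ProperClause V, ∑ u ∈ B,
          ((jumpReach ℓ f I {u, u.negate} u).card : ℝ) * ((reach ℓ f I B).card : ℝ) ^ k := by
          refine expect_le_expect fun f _ => ?_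
          rw [← sum_mul, pow_succ']
          gcongr
          exact_mod_cast (card_le_card (reach_subset_biUnion ℓ f I B)).trans card_biUnion_le
      _ ≤ B.card * ((ℓ + 1) * C (B.card + 2 * ℓ)) := by
          rw [expect_sum_comm, ← nsmul_eq_mul]
          exact sum_le_card_nsmul _ _ _ fun u _ => hmain u
      _ ≤ _ := by
          simp only [C]
          push_cast
          rw [pow_succ']
          have h : (B.card + 2 * ℓ + 2 * k * ℓ : ℝ) = B.card + 2 * (k + 1) * ℓ := by ring
          rw [h, ← mul_assoc]
          gcongr
          have : (0 : ℝ) ≤ 2 * (k + 1) * ℓ := by positivity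
          linarith

end Moments

/-! ### Small subformulas witnessing the contribution of a variable -/

section Witness

variable {ι V : Type}

lemma ucpLits_eq {m : ℕ} (f : Fin m → Clause V) (l : Lit V) :
    ucpLits (List.ofFn f) l = {v | ∃ a, JumpWalk f ∅ ∅ l a v} := by
  refine Set.Subset.antisymm (Set.sInter_subset_of_mem ⟨⟨0, .refl⟩, ?_⟩) ?_
  · intro c hc
    obtain ⟨i, rfl⟩ := (List.mem_ofFn' f c).1 hc
    exact ⟨fun ⟨a, h⟩ => ⟨a + 1, h.step (i := i) (by simp) (.inl ⟨by simp, rfl⟩)⟩,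
      fun ⟨a, h⟩ => ⟨a + 1, h.step (i := i) (by simp) (.inr ⟨by simp, rfl⟩)⟩⟩
  · rintro v ⟨a, h⟩ M ⟨hl, hM⟩
    induction h with
    | refl => exact hl
    | @step a w z i _ _ harc ih =>
      have := hM (f i) ((List.mem_ofFn' f _).2 ⟨i, rfl⟩)
      rcases harc with ⟨h1, rfl⟩ | ⟨h1, rfl⟩
      · exact this.1 (by simpa [h1] using ih)
      · exact this.2 (by simpa [h1] using ih)
    | jump _ hw => simp at hw

variable [Fintype ι] [DecidableEq ι]

/-- The variables reached by unit clause propagation from `l` along the clauses with index in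
`A`. -/
def reachVars (f : ι → Clause V) (A : Finset ι) (l : Lit V) : Set V :=
  Prod.snd '' {v | ∃ a, JumpWalk f Aᶜ ∅ l a v}

/-- The contribution of the variable `x`, truncated at `L`, when only the clauses with index in
`A` are used. -/
noncomputable def truncVal (L : ℝ) (f : ι → Clause V) (A : Finset ι) (x : V) : ℝ :=
  min (((reachVars f A (true, x)).ncard : ℝ) ^ 2 + ((reachVars f A (false, x)).ncard : ℝ) ^ 2) L

lemma truncVal_le (L : ℝ) (f : ι → Clause V) (A : Finset ι) (x : V) : truncVal L f A x ≤ L :=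
  min_le_right _ _

lemma truncVal_nonneg {L : ℝ} (hL : 0 ≤ L) (f : ι → Clause V) (A : Finset ι) (x : V) :
    0 ≤ truncVal L f A x :=
  le_min (by positivity) hL

lemma reachVars_mono (f : ι → Clause V) {A B : Finset ι} (h : A ⊆ B) (l : Lit V) :
    reachVars f A l ⊆ reachVars f B l :=
  Set.image_mono fun _ ⟨a, ha⟩ => ⟨a, ha.mono (compl_subset_compl.2 h) subset_rfl⟩

lemma truncVal_mono [Finite V] (L : ℝ) (f : ι → Clause V) {A B : Finset ι} (h : A ⊆ B) (x : V) :
    truncVal L f A x ≤ truncVal L f B x := by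
  have hle : ∀ l, ((reachVars f A l).ncard : ℝ) ≤ (reachVars f B l).ncard := fun l => by
    exact_mod_cast Set.ncard_le_ncard (reachVars_mono f h l) (Set.toFinite _)
  have h1 := hle (true, x)
  have h2 := hle (false, x)
  unfold truncVal
  gcongr

lemma truncVal_congr (L : ℝ) {f g : ι → Clause V} {A : Finset ι} (h : ∀ i ∈ A, f i = g i) (x : V) :
    truncVal L f A x = truncVal L g A x := by
  have : ∀ l a v, JumpWalk f Aᶜ ∅ l a v ↔ JumpWalk g Aᶜ ∅ l a v := fun l a v =>
    JumpWalk.congr_iff fun i hi => h i (by simpa using hi)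
  simp only [truncVal, reachVars, this]

lemma Yval_eq {n m : ℕ} (f : FSpace n m) :
    Yval n (toCNF f) = ∑ x, truncVal (Real.log n ^ 4) f univ x := by
  simp only [Yval, truncVal, reachVars, ucpVars, toCNF, ucpLits_eq, compl_univ]

variable [DecidableEq V]

/-- Exploring the literals reachable from `l` one at a time. -/
lemma exists_exploration (f : ι → Clause V) (l : Lit V) (q : ℕ) :
    ∃ (A : Finset ι) (S : Finset (Lit V)), A.card + 1 ≤ S.card ∧ S.card ≤ q + 1 ∧ l ∈ S ∧
      (∀ v ∈ S, ∃ a < S.card, JumpWalk f Aᶜ ∅ l a v) ∧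
      (∀ i ∈ A, ∃ u ∈ S, ∃ v, Arc (f i) u v) ∧
      (S.card = q + 1 ∨ ∀ a v, JumpWalk f ∅ ∅ l a v → v ∈ S) := by
  induction q with
  | zero => exact ⟨∅, {l}, by simp, by simp, by simp, by simpa using .refl, by simp, by simp⟩
  | succ q ih =>
    obtain ⟨A, S, hAS, hSq, hl, hS, hA, hq⟩ := ih
    by_cases hcl : ∀ a v, JumpWalk f ∅ ∅ l a v → v ∈ S
    · exact ⟨A, S, hAS, by omega, hl, hS, hA, .inr hcl⟩
    replace hq := hq.resolve_right hcl
    obtain ⟨i, w, hw, z, hz, harc⟩ : ∃ i, ∃ w ∈ S, ∃ z ∉ S, Arc (f i) w z := by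
      by_contra! hno
      refine hcl fun a v h => ?_
      induction h with
      | refl => exact hl
      | step _ _ harc ih => exact by_contra fun hz => hno _ _ ih _ hz harc
      | jump _ hw => simp at hw
    have hcompl : (insert i A)ᶜ ⊆ Aᶜ := compl_subset_compl.2 (subset_insert _ _)
    refine ⟨insert i A, insert z S, ?_, ?_, by simp [hl], ?_, ?_, .inl ?_⟩
    · have := card_insert_le i A
      rw [card_insert_of_notMem hz]
      omega
    · rw [card_insert_of_notMem hz]
      omega
    · intro v hv
      rw [card_insert_of_notMem hz]
      rcases mem_insert.1 hv with rfl | hv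
      · obtain ⟨a, ha, h⟩ := hS w hw
        exact ⟨a + 1, by omega, (h.mono hcompl subset_rfl).step (by simp) harc⟩
      · obtain ⟨a, ha, h⟩ := hS v hv
        exact ⟨a, by omega, h.mono hcompl subset_rfl⟩
    · intro j hj
      rcases mem_insert.1 hj with rfl | hj
      · exact ⟨w, by simp [hw], z, harc⟩
      · obtain ⟨u, hu, h⟩ := hA j hj
        exact ⟨u, by simp [hu], h⟩
    · rw [card_insert_of_notMem hz, hq]

/-- A few clauses near `x` suffice to determine the truncated contribution of `x`. -/
lemma exists_witness [Finite V] {L : ℝ} {N : ℕ} (hN : 1 ≤ N) (hL : L ≤ (N : ℝ) ^ 2)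
    (f : ι → Clause V) (x : V) :
    ∃ A : Finset ι, A.card ≤ 4 * N ∧ truncVal L f univ x ≤ truncVal L f A x ∧
      ∀ i ∈ A, ∃ σ u v, Arc (f i) u v ∧ ∃ a ≤ 2 * N, JumpWalk f ∅ ∅ (σ, x) a u := by
  choose A S hAS hSq _ hS hA hq using fun σ => exists_exploration f (σ, x) (2 * N - 1)
  have hAcard : ∀ σ, (A σ).card ≤ 2 * N := fun σ => by have := hAS σ; have := hSq σ; omega
  have hsub : ∀ σ, A σ ⊆ A true ∪ A false := fun σ => by
    cases σ
    exacts [subset_union_right, subset_union_left]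
  refine ⟨A true ∪ A false, (card_union_le _ _).trans ?_, ?_, ?_⟩
  · have := hAcard true
    have := hAcard false
    omega
  · have hlarge : ∀ σ, (S σ).card = 2 * N - 1 + 1 →
        L ≤ ((reachVars f (A true ∪ A false) (σ, x)).ncard : ℝ) ^ 2 := fun σ h => by
      refine hL.trans ?_
      have h1 : ((S σ).image Prod.snd : Set V) ⊆ reachVars f (A true ∪ A false) (σ, x) := by
        intro y hy
        obtain ⟨v, hv, rfl⟩ := mem_image.1 (mem_coe.1 hy)
        obtain ⟨a, -, h⟩ := hS σ v hv
        exact ⟨v, ⟨a, h.mono (compl_subset_compl.2 (hsub σ)) subset_rfl⟩, rfl⟩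
      have h2 := Set.ncard_le_ncard h1 (Set.toFinite _)
      rw [Set.ncard_coe_finset] at h2
      have h3 : (S σ).card ≤ ((univ : Finset Bool) ×ˢ (S σ).image Prod.snd).card :=
        card_le_card fun v hv => mem_product.2 ⟨mem_univ _, mem_image_of_mem _ hv⟩
      rw [card_product, card_univ, Fintype.card_bool] at h3
      have : N ≤ (reachVars f (A true ∪ A false) (σ, x)).ncard := by omega
      gcongr
    have hsmall : ∀ σ, (∀ a v, JumpWalk f ∅ ∅ (σ, x) a v → v ∈ S σ) →
        (reachVars f univ (σ, x)).ncard ≤ (reachVars f (A true ∪ A false) (σ, x)).ncard := by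
      intro σ h
      refine Set.ncard_le_ncard (Set.image_mono ?_) (Set.toFinite _)
      rintro v ⟨a, hv⟩
      rw [compl_univ] at hv
      obtain ⟨b, -, hb⟩ := hS σ v (h a v hv)
      exact ⟨b, hb.mono (compl_subset_compl.2 (hsub σ)) subset_rfl⟩
    rcases hq true with ht | ht
    · refine (truncVal_le _ _ _ _).trans (le_min ((hlarge true ht).trans ?_) le_rfl)
      exact le_add_of_nonneg_right (by positivity)
    rcases hq false with hf | hf
    · refine (truncVal_le _ _ _ _).trans (le_min ((hlarge false hf).trans ?_) le_rfl)
      exact le_add_of_nonneg_left (by positivity)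
    have h1 := hsmall true ht
    have h2 := hsmall false hf
    unfold truncVal
    gcongr
  · have hmem : ∀ σ, ∀ i ∈ A σ,
        ∃ τ u v, Arc (f i) u v ∧ ∃ a ≤ 2 * N, JumpWalk f ∅ ∅ (τ, x) a u := by
      intro σ i hi
      obtain ⟨u, hu, v, harc⟩ := hA σ i hi
      obtain ⟨a, ha, h⟩ := hS σ u hu
      have := hSq σ
      exact ⟨σ, u, v, harc, a, by omega, h.mono (empty_subset _) subset_rfl⟩
    intro i hi
    rcases mem_union.1 hi with hi | hi
    exacts [hmem _ i hi, hmem _ i hi]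

end Witness

/-! ### Sparse approximation -/

section Sparse

variable {ι V : Type} [DecidableEq ι] [Fintype V]

/-- The number of variables whose index set contains `i`. -/
def load (A : V → Finset ι) (i : ι) : ℕ := (univ.filter fun x => i ∈ A x).card

lemma sum_load (A : V → Finset ι) (O : Finset ι) :
    ∑ i ∈ O, load A i = ∑ x, (A x ∩ O).card := by
  simp only [load, card_filter]
  rw [sum_comm]
  refine sum_congr rfl fun x _ => ?_
  rw [← card_filter, filter_mem_eq_inter, inter_comm]

lemma load_mono {A B : V → Finset ι} (h : ∀ x, A x ⊆ B x) (i : ι) : load A i ≤ load B i :=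
  card_le_card fun x hx => by
    simp only [mem_filter, mem_univ, true_and] at hx ⊢
    exact h x hx

variable [Fintype ι] [DecidableEq V]

/-- The assignments of index sets to the variables that use no index more than `K` times. -/
def sparseFamilies (ι V : Type) [Fintype ι] [DecidableEq ι] [Fintype V] [DecidableEq V] (K : ℕ) :
    Finset (V → Finset ι) :=
  univ.filter fun A => ∀ i, load A i ≤ K

lemma mem_sparseFamilies {K : ℕ} {A : V → Finset ι} :
    A ∈ sparseFamilies ι V K ↔ ∀ i, load A i ≤ K := by
  simp [sparseFamilies]

lemma sparseFamilies_nonempty (K : ℕ) : (sparseFamilies ι V K).Nonempty :=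
  ⟨fun _ => ∅, mem_sparseFamilies.2 fun i => by simp [load]⟩

/-- The largest total truncated contribution that can be certified when every clause is used for
at most `K` variables. -/
noncomputable def sparseSum (K : ℕ) (L : ℝ) (f : ι → Clause V) : ℝ :=
  (sparseFamilies ι V K).sup' (sparseFamilies_nonempty K) fun A => ∑ x, truncVal L f (A x) x

lemma le_sparseSum {K : ℕ} {A : V → Finset ι} (hA : ∀ i, load A i ≤ K) (L : ℝ)
    (f : ι → Clause V) : ∑ x, truncVal L f (A x) x ≤ sparseSum K L f :=
  le_sup' (fun A : V → Finset ι => ∑ x, truncVal L f (A x) x) (mem_sparseFamilies.2 hA)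

lemma sparseSum_le (K : ℕ) (L : ℝ) (f : ι → Clause V) :
    sparseSum K L f ≤ ∑ x, truncVal L f univ x :=
  sup'_le _ _ fun _ _ => sum_le_sum fun x _ => truncVal_mono L f (subset_univ _) x

/-- Changing one clause hardly affects the sparse sum. -/
lemma sparseSum_le_add (K : ℕ) {L : ℝ} (hL : 0 ≤ L) {f g : ι → Clause V} {i : ι}
    (h : ∀ j, j ≠ i → f j = g j) : sparseSum K L f ≤ sparseSum K L g + K * L := by
  refine sup'_le _ _ fun A hA => ?_
  rw [mem_sparseFamilies] at hA
  have h1 : ∀ x, truncVal L f (A x) x ≤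
      truncVal L g ((A x).erase i) x + if i ∈ A x then L else 0 := fun x => by
    split_ifs with hi
    · linarith [truncVal_le L f (A x) x, truncVal_nonneg hL g ((A x).erase i) x]
    · rw [erase_eq_of_notMem hi, add_zero, truncVal_congr]
      exact fun j hj => h j fun hji => hi (hji ▸ hj)
  calc ∑ x, truncVal L f (A x) x
      ≤ ∑ x, truncVal L g ((A x).erase i) x + load A i * L := by
        refine (sum_le_sum fun x _ => h1 x).trans_eq ?_
        rw [sum_add_distrib, ← sum_filter, sum_const, nsmul_eq_mul, load]
    _ ≤ _ := by
        refine add_le_add (le_sparseSum (fun j => ?_) L g) ?_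
        · exact (load_mono (fun x => erase_subset _ _) j).trans (hA j)
        · have := hA i
          gcongr

/-- The indices used more than `K` times. -/
def overloaded (A : V → Finset ι) (K : ℕ) : Finset ι := univ.filter fun i => K < load A i

lemma sum_truncVal_le {A : V → Finset ι} {L : ℝ} (hL : 0 ≤ L) (K : ℕ) {f : ι → Clause V}
    (hA : ∀ x, truncVal L f univ x ≤ truncVal L f (A x) x) :
    ∑ x, truncVal L f univ x ≤ sparseSum K L f +
      (univ.filter fun x => ¬ Disjoint (A x) (overloaded A K)).card * L := by
  let A' : V → Finset ι := fun x => if Disjoint (A x) (overloaded A K) then A x else ∅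
  have hA' : ∀ i, load A' i ≤ K := fun i => by
    by_cases hi : i ∈ overloaded A K
    · have : load A' i = 0 := by
        rw [load, card_eq_zero, filter_eq_empty_iff]
        intro x _ hx
        simp only [A'] at hx
        split_ifs at hx with hd
        · exact disjoint_left.1 hd hx hi
        · simp at hx
      omega
    · refine (load_mono (fun x => ?_) i).trans (not_lt.1 fun h => hi (mem_filter.2 ⟨mem_univ _, h⟩))
      simp only [A']
      split_ifs <;> simp
  calc ∑ x, truncVal L f univ x
      ≤ ∑ x, (truncVal L f (A' x) x +
          if ¬ Disjoint (A x) (overloaded A K) then L else 0) := by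
        refine sum_le_sum fun x _ => ?_
        by_cases hd : Disjoint (A x) (overloaded A K)
        · simpa [A', hd] using hA x
        · simpa [A', hd] using
            (truncVal_le L f univ x).trans (le_add_of_nonneg_left (truncVal_nonneg hL f ∅ x))
    _ ≤ _ := by
        rw [sum_add_distrib, ← sum_filter, sum_const, nsmul_eq_mul]
        exact add_le_add_left (le_sparseSum hA' L f) _

omit [DecidableEq V] in
lemma exists_small_cover {A : V → Finset ι} {K b s w : ℕ} (hw : 0 < w)
    (hA : ∀ x, (A x).card ≤ w) (hbs : b * w ≤ s * K)
    (hb : b ≤ (univ.filter fun x => ¬ Disjoint (A x) (overloaded A K)).card) :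
    ∃ O : Finset ι, O.card ≤ s ∧ b ≤ (univ.filter fun x => ¬ Disjoint (A x) O).card := by
  by_cases hs : (overloaded A K).card ≤ s
  · exact ⟨_, hs, hb⟩
  obtain ⟨O, hO, rfl⟩ := exists_subset_card_eq (not_le.1 hs).le
  refine ⟨O, le_rfl, Nat.le_of_mul_le_mul_right (hbs.trans ?_) hw⟩
  calc O.card * K ≤ ∑ i ∈ O, load A i := by
        rw [← smul_eq_mul]
        exact card_nsmul_le_sum _ _ _ fun i hi => (mem_filter.1 (hO hi)).2.le
    _ = ∑ x, (A x ∩ O).card := sum_load A O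
    _ ≤ ∑ x, if ¬ Disjoint (A x) O then w else 0 := by
        refine sum_le_sum fun x _ => ?_
        split_ifs with hd
        · simp [disjoint_iff_inter_eq_empty.1 hd]
        · exact (card_le_card inter_subset_left).trans (hA x)
    _ = _ := by rw [← sum_filter, sum_const, smul_eq_mul]

/-- If the total truncated contribution is not well approximated by the sparse sum, then many
literals are reachable from few. -/
lemma exists_large_reach {K b s N : ℕ} {L : ℝ} (hN : 1 ≤ N) (hL0 : 0 ≤ L) (hL : L ≤ (N : ℝ) ^ 2)
    (hbs : b * (4 * N) ≤ s * K) (hs : 2 * s ≤ Fintype.card (Lit V)) (f : ι → ProperClause V)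
    (hf : sparseSum K L (fun i => (f i : Clause V)) + b * L <
      ∑ x, truncVal L (fun i => (f i : Clause V)) univ x) :
    ∃ R ∈ powersetCard (2 * s) (univ : Finset (Lit V)), b ≤ (reach (2 * N) f ∅ R).card := by
  choose A hAcard hA hnear using exists_witness hN hL fun i => (f i : Clause V)
  obtain ⟨O, hO, hbO⟩ := exists_small_cover (by omega) hAcard hbs <| by
    by_contra! hlt
    have h1 := sum_truncVal_le hL0 K hA
    have h2 : ((univ.filter fun x => ¬ Disjoint (A x) (overloaded A K)).card : ℝ) ≤ b := by
      exact_mod_cast hlt.le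
    nlinarith
  let heads : Finset (Lit V) := O.biUnion fun i => {(f i).1.1, (f i).1.2}
  have hheads : heads.card ≤ 2 * s := by
    refine card_biUnion_le.trans ((sum_le_card_nsmul _ _ 2 fun i _ => card_le_two).trans ?_)
    rw [smul_eq_mul]
    omega
  obtain ⟨R, hR, hRcard⟩ := exists_superset_card_eq hheads hs
  refine ⟨R, mem_powersetCard.2 ⟨subset_univ _, hRcard⟩, hbO.trans ?_⟩
  refine (card_le_card (t := (reach (2 * N) f ∅ R).image Prod.snd) fun x hx => ?_).trans
    card_image_le
  obtain ⟨i, hiA, hiO⟩ := not_disjoint_iff.1 (mem_filter.1 hx).2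
  obtain ⟨σ, u, v, harc, a, ha, hwalk⟩ := hnear x i hiA
  refine mem_image.2 ⟨Lit.negate (σ, x), mem_filter.2 ⟨mem_univ _, u.negate, hR ?_, a, ha,
    hwalk.contrapose⟩, rfl⟩
  refine mem_biUnion.2 ⟨i, hiO, ?_⟩
  rcases harc with ⟨h, -⟩ | ⟨h, -⟩ <;> simp [← h]

end Sparse

/-! ### The tail bound -/

section Tail

lemma sum_validFormulas (n m : ℕ) (g : FSpace n m → ℝ) :
    ∑ f ∈ validFormulas n m, g f = ∑ f : Fin m → ProperClause (Fin n), g fun i => f i := by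
  rw [sum_subtype (p := fun f : FSpace n m => ∀ i, (f i).1.2 ≠ (f i).2.2) _
    (by simp [validFormulas])]
  exact Fintype.sum_equiv (Equiv.subtypePiEquivPi (α := Fin m) (β := fun _ => Clause (Fin n))
    (p := fun _ c => c.1.2 ≠ c.2.2)) _ _
    fun _ => rfl

lemma expF_eq_expect (n m : ℕ) (g : FSpace n m → ℝ) :
    expF n m g = 𝔼 f : Fin m → ProperClause (Fin n), g fun i => f i := by
  have hcard := sum_validFormulas n m fun _ => 1
  simp only [sum_const, nsmul_eq_mul, mul_one, card_univ] at hcard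
  rw [expF, sum_validFormulas, Fintype.expect_eq_sum_div_card, hcard]

lemma prF_eq_expect (n m : ℕ) (P : FSpace n m → Prop) :
    prF n m P = 𝔼 f : Fin m → ProperClause (Fin n), if P fun i => f i then (1 : ℝ) else 0 := by
  rw [← expF_eq_expect n m fun f => if P f then (1 : ℝ) else 0, expF, sum_boole, prF]

lemma expect_exists_large_reach_le {n m s ℓ b : ℕ} (hn : 2 ≤ n) (hb : 0 < b)
    (hsub : m * (1 + (2 * ℓ + 2 : ℝ) ^ 2 / (2 * (n - 1))) ≤ n) (k : ℕ) :
    𝔼 f : Fin m → ProperClause (Fin n),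
      (if ∃ R ∈ powersetCard (2 * s) (univ : Finset (Lit (Fin n))), b ≤ (reach ℓ f ∅ R).card
        then (1 : ℝ) else 0) ≤
      (2 * n : ℝ) ^ (2 * s) * ((2 * s + 2 * k * ℓ) * (ℓ + 1) / b) ^ k := by
  have hb' : (0 : ℝ) < b := by exact_mod_cast hb
  calc _ ≤ 𝔼 f : Fin m → ProperClause (Fin n),
          ∑ R ∈ powersetCard (2 * s) (univ : Finset (Lit (Fin n))),
            ((reach ℓ f ∅ R).card : ℝ) ^ k / (b : ℝ) ^ k := by
        refine expect_le_expect fun f _ => ?_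
        have hnn : ∀ R ∈ powersetCard (2 * s) (univ : Finset (Lit (Fin n))),
            0 ≤ ((reach ℓ f ∅ R).card : ℝ) ^ k / (b : ℝ) ^ k := fun R _ => by positivity
        split_ifs with h
        · obtain ⟨R, hR, hbR⟩ := h
          refine le_trans ?_ (single_le_sum hnn hR)
          rw [one_le_div (by positivity)]
          gcongr
        · exact sum_nonneg hnn
    _ ≤ ∑ R ∈ powersetCard (2 * s) (univ : Finset (Lit (Fin n))),
          ((2 * s + 2 * k * ℓ) * (ℓ + 1) / b : ℝ) ^ k := by
        rw [expect_sum_comm]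
        refine sum_le_sum fun R hR => ?_
        rw [← expect_div, div_pow]
        have := expect_card_reach_pow_le (ι := Fin m) (V := Fin n) (ℓ := ℓ) (by simpa using hn)
          (by simpa using hsub) k ∅ R
        rw [(mem_powersetCard.1 hR).2] at this
        push_cast at this
        gcongr
    _ ≤ _ := by
        rw [sum_const, nsmul_eq_mul, card_powersetCard, card_univ]
        gcongr
        have hchoose := Nat.choose_le_pow (Fintype.card (Lit (Fin n))) (2 * s)
        simp only [Fintype.card_prod, Fintype.card_bool, Fintype.card_fin] at hchoose ⊢
        exact_mod_cast hchoose

/-- A non-asymptotic tail bound for `Y`. -/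
theorem prF_Yval_le {n m K b s N k : ℕ} {t a : ℝ} (hn : 2 ≤ n) (hb : 0 < b) (hN : 1 ≤ N)
    (hL : Real.log n ^ 4 ≤ (N : ℝ) ^ 2)
    (hsub : m * (1 + (4 * N + 2 : ℝ) ^ 2 / (2 * (n - 1))) ≤ n)
    (hbs : b * (4 * N) ≤ s * K) (hs : s ≤ n) (ht : 0 ≤ t) (htK : t * (K * Real.log n ^ 4) ≤ 1) :
    prF n m (fun f => Yval n (toCNF f) ≥
      expF n m (fun f' => Yval n (toCNF f')) + (a + b * Real.log n ^ 4)) ≤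
      Real.exp (m * (t * (K * Real.log n ^ 4)) ^ 2 - t * a) +
        (2 * n : ℝ) ^ (2 * s) * ((2 * s + 4 * k * N) * (2 * N + 1) / b) ^ k := by
  set L := Real.log n ^ 4
  have hL0 : 0 ≤ L := by positivity
  have : Nonempty (ProperClause (Fin n)) := nonempty_properClause (by simpa using hn)
  let Z : (Fin m → ProperClause (Fin n)) → ℝ := fun f => sparseSum K L fun i => (f i : Clause (Fin n))
  have hZ := tail_le_of_bounded_differences (a := a) ht htK m Z fun f g i h =>
    sparseSum_le_add K hL0 fun j hj => congrArg Subtype.val (h j hj)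
  have hR := expect_exists_large_reach_le (s := s) (ℓ := 2 * N) hn hb
    (by push_cast; convert hsub using 5; ring) k
  have hEZ : 𝔼 f, Z f ≤ expF n m (fun f => Yval n (toCNF f)) := by
    rw [expF_eq_expect]
    refine expect_le_expect fun f _ => ?_
    rw [Yval_eq]
    exact sparseSum_le K L _
  rw [prF_eq_expect]
  refine (expect_indicator_mono (Q := fun f => (𝔼 g, Z g) + a ≤ Z f) (R := fun f =>
    ∃ R ∈ powersetCard (2 * s) (univ : Finset (Lit (Fin n))), b ≤ (reach (2 * N) f ∅ R).card)
    fun f hf => ?_).trans (add_le_add ?_ ?_)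
  · by_cases hlt : Z f + b * L < ∑ x, truncVal L (fun i => (f i : Clause (Fin n))) univ x
    · refine .inr (exists_large_reach hN hL0 hL hbs ?_ f hlt)
      simp only [Fintype.card_prod, Fintype.card_bool, Fintype.card_fin]
      omega
    · left
      rw [Yval_eq] at hf
      change Z f ≥ _
      linarith
  · convert hZ
  · rw [show (4 * k * N : ℝ) = 2 * k * (2 * N) by ring]
    push_cast at hR
    refine le_of_eq_of_le (expect_congr rfl fun f _ => ?_) hR
    congr

end Tail

/-! ### Asymptotics -/

section Asymptotics

lemma natCeil_le_two_mul {r : ℝ} (hr : 1 ≤ r) : (⌈r⌉₊ : ℝ) ≤ 2 * r := by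
  linarith [(Nat.ceil_lt_add_one (zero_le_one.trans hr)).le]

lemma exp_sub_one_le_half (r : ℝ) : Real.exp (r - 1) ≤ Real.exp r / 2 := by
  rw [Real.exp_sub]
  gcongr
  linarith [Real.add_one_le_exp (1 : ℝ)]

set_option maxHeartbeats 800000 in
/-- The choice of the parameters in `prF_Yval_le`, in terms of `y = n ^ 0.01`. -/
lemma prF_Yval_le_exp {n m : ℕ} {β y : ℝ} (hn : 2 ≤ n) (hy0 : 0 ≤ y) (hny : (n : ℝ) = y ^ 100)
    (hlog : 1 ≤ Real.log n) (hy : 1000 * Real.log n ^ 8 ≤ y) (hβ0 : 0 ≤ β) (hm : m ≤ β * n)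
    (hβy : 1 ≤ (1 - β) * y) :
    prF n m (fun f => Yval n (toCNF f) ≥ expF n m (fun f' => Yval n (toCNF f')) + y ^ 90) ≤
      Real.exp (-y ^ 70) := by
  set l := Real.log n
  have hl8 : (1 : ℝ) ≤ l ^ 8 := one_le_pow₀ hlog
  have hl4 : l ^ 4 ≤ l ^ 8 := pow_le_pow_right₀ hlog (by norm_num)
  have hl1 : l ≤ l ^ 8 := le_self_pow₀ hlog (by norm_num)
  have hy1 : 1000 ≤ y := by linarith
  have hy1' : 1 ≤ y := by linarith
  have hpow : ∀ k, 1 ≤ y ^ k := fun k => one_le_pow₀ hy1'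
  have hstep : ∀ {i j : ℕ}, i + 1 = j → 1000 * y ^ i ≤ y ^ j := fun h => by
    rw [← h, pow_succ']
    exact mul_le_mul_of_nonneg_right hy1 (by positivity)
  have hmono : ∀ {i j : ℕ}, i ≤ j → y ^ i ≤ y ^ j := fun h => pow_le_pow_right₀ hy1' h
  have hβ1 : β ≤ 1 := by
    by_contra! h
    nlinarith
  set N := ⌈l ^ 2⌉₊
  set s := ⌈y ^ 80⌉₊
  set K := ⌈y ^ 3⌉₊
  set b := ⌈y ^ 82⌉₊
  set k := ⌈y ^ 81⌉₊
  have hN : l ^ 2 ≤ N := Nat.le_ceil _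
  have hN' : (N : ℝ) ≤ 2 * l ^ 2 := natCeil_le_two_mul (one_le_pow₀ hlog)
  have hs : y ^ 80 ≤ s := Nat.le_ceil _
  have hs' : (s : ℝ) ≤ 2 * y ^ 80 := natCeil_le_two_mul (hpow _)
  have hK : y ^ 3 ≤ K := Nat.le_ceil _
  have hK' : (K : ℝ) ≤ 2 * y ^ 3 := natCeil_le_two_mul (hpow _)
  have hb : y ^ 82 ≤ b := Nat.le_ceil _
  have hb' : (b : ℝ) ≤ 2 * y ^ 82 := natCeil_le_two_mul (hpow _)
  have hk : y ^ 81 ≤ k := Nat.le_ceil _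
  have hk' : (k : ℝ) ≤ 2 * y ^ 81 := natCeil_le_two_mul (hpow _)
  have hN1 : (1 : ℝ) ≤ N := (one_le_pow₀ hlog).trans hN
  have hNsq : (N : ℝ) ^ 2 ≤ y / 250 := by
    have : (N : ℝ) ^ 2 ≤ (2 * l ^ 2) ^ 2 := by gcongr
    nlinarith
  have hNy : (N : ℝ) ≤ y / 250 := by nlinarith
  have hL0 : 0 ≤ l ^ 4 := by positivity
  have hLy : l ^ 4 ≤ y / 1000 := by linarith
  have hbL : b * l ^ 4 ≤ y ^ 90 / 2 := by
    have : b * l ^ 4 ≤ 2 * y ^ 82 * (y / 1000) := by gcongr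
    have := hmono (show 83 ≤ 90 by norm_num)
    nlinarith [hpow 83]
  have hmain := prF_Yval_le (n := n) (m := m) (K := K) (b := b) (s := s) (N := N) (k := k)
    (t := 1 / y ^ 17) (a := y ^ 90 - b * l ^ 4) hn ?_ ?_ ?_ ?_ ?_ ?_ (by positivity) ?_
  · rw [sub_add_cancel] at hmain
    refine hmain.trans ?_
    have h1 : Real.exp (m * (1 / y ^ 17 * (K * l ^ 4)) ^ 2 - 1 / y ^ 17 * (y ^ 90 - b * l ^ 4)) ≤
        Real.exp (-y ^ 70 - 1) := by
      refine Real.exp_le_exp.2 ?_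
      have hmn : (m : ℝ) ≤ y ^ 100 := by
        rw [← hny]
        exact hm.trans (mul_le_of_le_one_left (Nat.cast_nonneg _) hβ1)
      have h2 : m * (1 / y ^ 17 * (K * l ^ 4)) ^ 2 ≤
          y ^ 100 * (1 / y ^ 17 * (2 * y ^ 3 * l ^ 4)) ^ 2 := by
        gcongr
      have h3 : y ^ 100 * (1 / y ^ 17 * (2 * y ^ 3 * l ^ 4)) ^ 2 = 4 * y ^ 72 * l ^ 8 := by
        field_simp
        ring
      have h4 : 4 * y ^ 72 * l ^ 8 ≤ 4 * y ^ 72 * (y / 1000) := by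
        have : l ^ 8 ≤ y / 1000 := by linarith
        gcongr
      have h5 : y ^ 73 / 2 ≤ 1 / y ^ 17 * (y ^ 90 - b * l ^ 4) := by
        rw [one_div_mul_eq_div, le_div_iff₀ (by positivity)]
        linarith [show y ^ 73 / 2 * y ^ 17 = y ^ 90 / 2 by ring]
      have h6 := hmono (show 70 ≤ 72 by norm_num)
      have h7 := hstep (show 72 + 1 = 73 by norm_num)
      have h8 := hpow 72
      linarith [show 4 * y ^ 72 * (y / 1000) = y ^ 73 / 250 by ring]
    have h2 : (2 * n : ℝ) ^ (2 * s) * ((2 * s + 4 * k * N) * (2 * N + 1) / b) ^ k ≤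
        Real.exp (-y ^ 70 - 1) := by
      have hratio : (2 * s + 4 * k * N) * (2 * N + 1) / b ≤ Real.exp (-1) := by
        rw [div_le_iff₀ (lt_of_lt_of_le (by positivity) hb)]
        have h3 : (2 * s + 4 * k * N : ℝ) ≤ 12 * y ^ 81 * N := by
          have := hmono (show 80 ≤ 81 by norm_num)
          have h4 : (k * N : ℝ) ≤ 2 * y ^ 81 * N := by gcongr
          nlinarith [hpow 81]
        have h4 : (2 * N + 1 : ℝ) ≤ 3 * N := by linarith
        have h5 := Real.exp_neg_one_gt_d9
        calc (2 * s + 4 * k * N) * (2 * N + 1) ≤ 12 * y ^ 81 * N * (3 * N) := by gcongr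
          _ = 36 * y ^ 81 * (N : ℝ) ^ 2 := by ring
          _ ≤ 36 * y ^ 81 * (y / 250) := by gcongr
          _ ≤ 0.3 * y ^ 82 := by nlinarith [hpow 82]
          _ ≤ Real.exp (-1) * b := by
            refine mul_le_mul ?_ hb (by positivity) (by positivity)
            norm_num at h5 ⊢
            linarith
      have hbase : (2 * n : ℝ) ≤ Real.exp (2 * l) := by
        have hn0 : (0 : ℝ) < n := by positivity
        have hn2 : (2 : ℝ) ≤ n := by exact_mod_cast hn
        rw [two_mul l, Real.exp_add, Real.exp_log hn0]
        gcongr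
      calc _ ≤ Real.exp (2 * l) ^ (2 * s) * Real.exp (-1) ^ k := by gcongr
        _ = Real.exp (4 * s * l - k) := by
          rw [← Real.exp_nat_mul, ← Real.exp_nat_mul, ← Real.exp_add]
          push_cast
          ring_nf
        _ ≤ _ := by
          refine Real.exp_le_exp.2 ?_
          have h3 : 4 * s * l ≤ 4 * (2 * y ^ 80) * (y / 1000) := by
            have : l ≤ y / 1000 := by linarith
            gcongr
          have h4 := hmono (show 70 ≤ 80 by norm_num)
          have h5 := hstep (show 80 + 1 = 81 by norm_num)
          have h6 := hpow 80
          linarith [show 4 * (2 * y ^ 80) * (y / 1000) = y ^ 81 / 125 by ring]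
    linarith [exp_sub_one_le_half (-y ^ 70)]
  · exact_mod_cast zero_lt_one.trans_le ((hpow _).trans hb)
  · exact_mod_cast hN1
  · calc l ^ 4 = (l ^ 2) ^ 2 := by ring
      _ ≤ _ := by gcongr
  · have hn1 : (2 : ℝ) ≤ n := by exact_mod_cast hn
    have h1 : (4 * N + 2 : ℝ) ^ 2 ≤ y := by
      have : (4 * N + 2 : ℝ) ^ 2 ≤ (6 * N) ^ 2 := by
        gcongr
        linarith
      nlinarith
    have h2 : (4 * N + 2 : ℝ) ^ 2 / (2 * (n - 1)) ≤ 1 - β := by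
      rw [div_le_iff₀ (by linarith)]
      have h3 : y ^ 2 ≤ n := hny ▸ hmono (by norm_num)
      nlinarith
    calc (m : ℝ) * (1 + (4 * N + 2 : ℝ) ^ 2 / (2 * (n - 1))) ≤ β * n * (1 + (1 - β)) := by
          have : (0 : ℝ) < n - 1 := by linarith
          gcongr
      _ = n - n * (1 - β) ^ 2 := by ring
      _ ≤ n := sub_le_self _ (by positivity)
  · have h1 : (b * (4 * N) : ℝ) ≤ 2 * y ^ 82 * (4 * (y / 250)) := by gcongr
    have h2 : y ^ 80 * y ^ 3 ≤ s * K := by gcongr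
    have h3 : (b * (4 * N) : ℝ) ≤ s * K := by nlinarith [hpow 83]
    exact_mod_cast h3
  · have h1 := hmono (show 81 ≤ 100 by norm_num)
    have h2 : (s : ℝ) ≤ n := by linarith [hstep (show 80 + 1 = 81 by norm_num), hpow 80]
    exact_mod_cast h2
  · rw [one_div_mul_eq_div, div_le_one (by positivity)]
    have h1 : K * l ^ 4 ≤ 2 * y ^ 3 * l ^ 4 := by gcongr
    have h2 := hmono (show 4 ≤ 17 by norm_num)
    nlinarith [hpow 4]

lemma eventually_log_pow_le_rpow : ∀ᶠ n : ℕ in atTop,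
    1000 * Real.log n ^ 8 ≤ (n : ℝ) ^ (0.01 : ℝ) := by
  have h := (isLittleO_log_rpow_rpow_atTop 8 (by norm_num : (0 : ℝ) < 0.01)).bound
    (by norm_num : (0 : ℝ) < 1 / 1000)
  filter_upwards [tendsto_natCast_atTop_atTop.eventually h] with n hn
  have h0 : (0 : ℝ) ≤ Real.log n := Real.log_natCast_nonneg n
  rw [Real.norm_of_nonneg (by positivity), Real.norm_of_nonneg (by positivity)] at hn
  have h8 : Real.log n ^ (8 : ℝ) = Real.log n ^ 8 := by exact_mod_cast Real.rpow_natCast _ 8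
  rw [h8] at hn
  linarith

end Asymptotics

end TwoSat

/-- **Corollary 3.5.** For every `0 < α < 1` with `m = m(n) ∼ αn` and all sufficiently large `n`,
the random 2-CNF `Φ = Φ_{n,m}` satisfies `Pr[Y(Φ) ≥ E[Y(Φ)] + n^{0.9}] ≤ exp(−n^{0.7})`. -/
theorem stmt_11 :
    ∀ α : ℝ, 0 < α → α < 1 →
      ∀ m : ℕ → ℕ, Tendsto (fun n => (m n : ℝ) / (n : ℝ)) atTop (nhds α) →
        ∀ᶠ n : ℕ in atTop,
          prF n (m n)
              (fun f =>
                Yval n (toCNF f) ≥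
                  expF n (m n) (fun f' => Yval n (toCNF f')) + (n : ℝ) ^ (0.9 : ℝ)) ≤
            Real.exp (-(n : ℝ) ^ (0.7 : ℝ)) := by
  intro α hα0 hα1 m hm
  obtain ⟨β, hαβ, hβ1⟩ := exists_between hα1
  have hy : Tendsto (fun n : ℕ => (n : ℝ) ^ (0.01 : ℝ)) atTop atTop :=
    (tendsto_rpow_atTop (by norm_num)).comp tendsto_natCast_atTop_atTop
  filter_upwards [eventually_ge_atTop 2, hm.eventually_le_const hαβ,
    TwoSat.eventually_log_pow_le_rpow, hy.eventually_ge_atTop (1 / (1 - β)),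
    (Real.tendsto_log_atTop.comp tendsto_natCast_atTop_atTop).eventually_ge_atTop 1]
    with n hn hmn hlog hβy hlog1
  have hpow : ∀ k : ℕ, ((n : ℝ) ^ (0.01 : ℝ)) ^ k = (n : ℝ) ^ (0.01 * k : ℝ) := fun k =>
    (Real.rpow_mul_natCast (Nat.cast_nonneg n) _ _).symm
  have hn0 : (0 : ℝ) < n := by positivity
  have h := TwoSat.prF_Yval_le_exp (n := n) (m := m n) (β := β) (y := (n : ℝ) ^ (0.01 : ℝ)) hn
    (by positivity) (by rw [hpow]; norm_num) hlog1 hlog (hα0.trans hαβ).le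
    ((div_le_iff₀ hn0).1 hmn)
    (by rwa [div_le_iff₀' (by linarith)] at hβy)
  rw [hpow, hpow] at h
  norm_num at h ⊢
  exact h
end

section
/- For every 0 < α < 1, the random 2-CNF Φ = Φ_{n,m} with m ~ αn clauses satisfies, with probability 1 − o(n^{−2}) as n → ∞, max_{1 ≤ i ≤ n} (|𝒱(Φ,{xᵢ})| + |𝒱(Φ,{¬xᵢ})|) ≤ log² n. -/
open Filter

open scoped Classical

/-- The 2-clauses on two distinct variables that do not contain the negation of a literal in `S`. -/
def avoiding {n : ℕ} (S : Finset (Lit (Fin n))) : Finset (Clause (Fin n)) :=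
  Finset.univ.filter fun d => d.1.2 ≠ d.2.2 ∧ d.1.negate ∉ S ∧ d.2.negate ∉ S

/-- The clauses in `avoiding S` that contain the negation of `w`. -/
def hitting {n : ℕ} (S : Finset (Lit (Fin n))) (w : Lit (Fin n)) : Finset (Clause (Fin n)) :=
  (avoiding S).filter fun d => d.1.negate = w ∨ d.2.negate = w

/-- The literal implied by `w` through a clause containing the negation of `w`. -/
def implied {n : ℕ} (w : Lit (Fin n)) (d : Clause (Fin n)) : Lit (Fin n) :=
  if d.1.negate = w then d.2 else d.1

/-- The variable of `v` does not occur in `W`. -/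
def IsFresh {n : ℕ} (W : Finset (Lit (Fin n))) (v : Lit (Fin n)) : Prop :=
  ∀ u ∈ W, u.2 ≠ v.2

/-- All variables of `d` occur in `W`, and `W` is closed under propagation along `d`. -/
def Settled {n : ℕ} (W : Finset (Lit (Fin n))) (d : Clause (Fin n)) : Prop :=
  ((∃ u ∈ W, u.2 = d.1.2) ∧ ∃ u ∈ W, u.2 = d.2.2) ∧
    (d.1.negate ∈ W → d.2 ∈ W) ∧ (d.2.negate ∈ W → d.1 ∈ W)

/-- The closure of a set of literals under negation. -/
def symClosure {n : ℕ} (W : Finset (Lit (Fin n))) : Finset (Lit (Fin n)) :=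
  W ∪ W.image Lit.negate

/-- The number of pairs of a literal in `W` and a clause index for which it is unexplored. -/
def unexplored {n m : ℕ} (W : Finset (Lit (Fin n))) (S : Fin m → Finset (Lit (Fin n))) : ℕ :=
  ∑ i, (W \ S i).card

/-- The knowledge about one clause in an exploration that has reached the literals in `W`: either
the clause is only known to avoid the negations of the literals in `s ⊆ W`, or it is known. -/
def ClauseState {n : ℕ} (W : Finset (Lit (Fin n))) (q : Finset (Clause (Fin n)))
    (s : Finset (Lit (Fin n))) : Prop :=
  (q = avoiding s ∧ s ⊆ W) ∨ ∃ d, q = {d} ∧ s = Finset.univ ∧ Settled W d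

/-- Every propagation-closed set of literals containing `W₀` has at least `K` elements. -/
def LargeClosure {n m : ℕ} (K : ℕ) (W₀ : Finset (Lit (Fin n))) (f : FSpace n m) : Prop :=
  ∀ W : Finset (Lit (Fin n)), W₀ ⊆ W → ucpClosed (toCNF f) (W : Set (Lit (Fin n))) → K ≤ W.card

theorem negate_negate {V : Type} (l : Lit V) : l.negate.negate = l := by
  simp [Lit.negate]

theorem negate_snd {V : Type} (l : Lit V) : l.negate.2 = l.2 := rfl

theorem negate_ne {V : Type} (l : Lit V) : l.negate ≠ l := by
  intro h
  have := congrArg Prod.fst h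
  simp [Lit.negate] at this

theorem eq_or_eq_negate {V : Type} {u v : Lit V} (h : u.2 = v.2) : v = u ∨ v = u.negate := by
  obtain ⟨a, x⟩ := u
  obtain ⟨b, y⟩ := v
  obtain rfl : x = y := h
  cases a <;> cases b <;> simp [Lit.negate]

theorem mem_symClosure {n : ℕ} {W : Finset (Lit (Fin n))} {v : Lit (Fin n)} :
    v ∈ symClosure W ↔ ∃ u ∈ W, u.2 = v.2 := by
  constructor
  · intro h
    rcases Finset.mem_union.1 h with h | h
    · exact ⟨v, h, rfl⟩
    · obtain ⟨u, hu, rfl⟩ := Finset.mem_image.1 h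
      exact ⟨u, hu, rfl⟩
  · rintro ⟨u, hu, h⟩
    rcases eq_or_eq_negate h with rfl | rfl
    · exact Finset.mem_union_left _ hu
    · exact Finset.mem_union_right _ (Finset.mem_image_of_mem _ hu)

theorem card_symClosure_le {n : ℕ} (W : Finset (Lit (Fin n))) :
    (symClosure W).card ≤ 2 * W.card := by
  have h1 := Finset.card_union_le W (W.image Lit.negate)
  have h2 := Finset.card_image_le (s := W) (f := Lit.negate)
  unfold symClosure
  omega

theorem Settled.symClosure {n : ℕ} {W : Finset (Lit (Fin n))} {d : Clause (Fin n)}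
    (h1 : ∃ u ∈ W, u.2 = d.1.2) (h2 : ∃ u ∈ W, u.2 = d.2.2) : Settled (symClosure W) d := by
  refine ⟨⟨?_, ?_⟩, fun _ => mem_symClosure.2 h2, fun _ => mem_symClosure.2 h1⟩
  · exact ⟨d.1, mem_symClosure.2 h1, rfl⟩
  · exact ⟨d.2, mem_symClosure.2 h2, rfl⟩

theorem Settled.insert {n : ℕ} {W : Finset (Lit (Fin n))} {d : Clause (Fin n)}
    {v : Lit (Fin n)} (hv : IsFresh W v) (h : Settled W d) : Settled (insert v W) d := by
  obtain ⟨⟨⟨a, ha, ha'⟩, ⟨b, hb, hb'⟩⟩, h1, h2⟩ := h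
  refine ⟨⟨⟨a, Finset.mem_insert_of_mem ha, ha'⟩, ⟨b, Finset.mem_insert_of_mem hb, hb'⟩⟩, ?_, ?_⟩
  · intro h
    rcases Finset.mem_insert.1 h with h | h
    · exact absurd (by rw [ha', ← h, negate_snd]) (hv a ha)
    · exact Finset.mem_insert_of_mem (h1 h)
  · intro h
    rcases Finset.mem_insert.1 h with h | h
    · exact absurd (by rw [hb', ← h, negate_snd]) (hv b hb)
    · exact Finset.mem_insert_of_mem (h2 h)

theorem ClauseState.insert {n : ℕ} {W : Finset (Lit (Fin n))} {q : Finset (Clause (Fin n))}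
    {s : Finset (Lit (Fin n))} {v : Lit (Fin n)} (hv : IsFresh W v) (h : ClauseState W q s) :
    ClauseState (insert v W) q s := by
  rcases h with ⟨h, hs⟩ | ⟨d, hq, hs, hd⟩
  · exact Or.inl ⟨h, hs.trans (Finset.subset_insert _ _)⟩
  · exact Or.inr ⟨d, hq, hs, hd.insert hv⟩

theorem ClauseState.symClosure {n : ℕ} {W : Finset (Lit (Fin n))} {q : Finset (Clause (Fin n))}
    {s : Finset (Lit (Fin n))} (h : ClauseState W q s) : ClauseState (symClosure W) q s := by
  rcases h with ⟨h, hs⟩ | ⟨d, hq, hs, hd⟩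
  · exact Or.inl ⟨h, hs.trans Finset.subset_union_left⟩
  · exact Or.inr ⟨d, hq, hs, Settled.symClosure hd.1.1 hd.1.2⟩

theorem mem_hitting {n : ℕ} {S : Finset (Lit (Fin n))} {w : Lit (Fin n)} {d : Clause (Fin n)}
    (h : d ∈ hitting S w) : d.1.2 ≠ d.2.2 ∧ (d.1.negate = w ∨ d.2.negate = w) := by
  have h' := Finset.mem_filter.1 h
  exact ⟨(Finset.mem_filter.1 h'.1).2.1, h'.2⟩

theorem eq_of_mem_hitting {n : ℕ} {S : Finset (Lit (Fin n))} {w : Lit (Fin n)}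
    {d : Clause (Fin n)} (h : d ∈ hitting S w) :
    (implied w d).2 ≠ w.2 ∧ (d = (w.negate, implied w d) ∨ d = (implied w d, w.negate)) := by
  obtain ⟨hd, h⟩ := mem_hitting h
  obtain ⟨d1, d2⟩ := d
  unfold implied
  dsimp only at *
  split_ifs with h1
  · subst h1
    exact ⟨fun h => hd h.symm, Or.inl (by rw [negate_negate])⟩
  · have h2 := h.resolve_left h1
    subst h2
    exact ⟨hd, Or.inr (by rw [negate_negate])⟩

theorem settled_insert_implied {n : ℕ} {S W : Finset (Lit (Fin n))} {w : Lit (Fin n)}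
    {d : Clause (Fin n)} (hw : w ∈ W) (hd : d ∈ hitting S w) (hf : IsFresh W (implied w d)) :
    Settled (insert (implied w d) W) d := by
  obtain ⟨-, hd⟩ := eq_of_mem_hitting hd
  have hw' : w ∈ insert (implied w d) W := Finset.mem_insert_of_mem hw
  have hm : implied w d ∈ insert (implied w d) W := Finset.mem_insert_self _ _
  have hn : (implied w d).negate ∉ insert (implied w d) W := by
    intro h
    rcases Finset.mem_insert.1 h with h | h
    · exact negate_ne _ h
    · exact hf _ h rfl
  generalize implied w d = v at *
  rcases hd with rfl | rfl
  · exact ⟨⟨⟨w, hw', rfl⟩, ⟨v, hm, rfl⟩⟩, fun _ => hm, fun h => absurd h hn⟩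
  · exact ⟨⟨⟨v, hm, rfl⟩, ⟨w, hw', rfl⟩⟩, fun h => absurd h hn, fun _ => hm⟩

theorem settled_symClosure_of_not_isFresh {n : ℕ} {S W : Finset (Lit (Fin n))} {w : Lit (Fin n)}
    {d : Clause (Fin n)} (hw : w ∈ W) (hd : d ∈ hitting S w) (hf : ¬ IsFresh W (implied w d)) :
    Settled (symClosure W) d := by
  obtain ⟨-, hd⟩ := eq_of_mem_hitting hd
  have hv : ∃ u ∈ W, u.2 = (implied w d).2 := by
    unfold IsFresh at hf
    push Not at hf
    exact hf
  generalize implied w d = v at *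
  rcases hd with rfl | rfl
  · exact Settled.symClosure ⟨w, hw, rfl⟩ hv
  · exact Settled.symClosure hv ⟨w, hw, rfl⟩

theorem avoiding_eq_union {n : ℕ} (S : Finset (Lit (Fin n))) (w : Lit (Fin n)) :
    avoiding S = avoiding (insert w S) ∪ hitting S w := by
  ext d
  simp only [avoiding, hitting, Finset.mem_union, Finset.mem_filter, Finset.mem_univ, true_and,
    Finset.mem_insert]
  tauto

theorem card_avoiding {n : ℕ} (S : Finset (Lit (Fin n))) (w : Lit (Fin n)) :
    (avoiding S).card = (avoiding (insert w S)).card + (hitting S w).card := by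
  rw [avoiding_eq_union S w, Finset.card_union_of_disjoint]
  rw [Finset.disjoint_left]
  intro d hd hd'
  have h1 := (Finset.mem_filter.1 hd).2.2
  rcases (mem_hitting hd').2 with h | h
  · exact h1.1 (h ▸ Finset.mem_insert_self _ _)
  · exact h1.2 (h ▸ Finset.mem_insert_self _ _)

theorem card_filter_snd_ne {n : ℕ} (x : Fin n) :
    (Finset.univ.filter fun v : Lit (Fin n) => v.2 ≠ x).card = 2 * (n - 1) := by
  have : (Finset.univ.filter fun v : Lit (Fin n) => v.2 ≠ x) =
      (Finset.univ : Finset Bool) ×ˢ (Finset.univ.erase x) := by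
    ext v
    simp
  rw [this, Finset.card_product, Finset.card_erase_of_mem (Finset.mem_univ _)]
  simp

/-- A family of clauses containing `¬ w` is at most twice as large as the set of literals
that these clauses may imply. -/
theorem card_le_of_implied_mem {n : ℕ} {S : Finset (Lit (Fin n))} {w : Lit (Fin n)}
    {D : Finset (Clause (Fin n))} {T : Finset (Lit (Fin n))}
    (hD : D ⊆ hitting S w) (hT : ∀ d ∈ D, implied w d ∈ T) : D.card ≤ 2 * T.card := by
  have hsub : D ⊆ T.image (fun v => (w.negate, v)) ∪ T.image (fun v => (v, w.negate)) := by
    intro d hd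
    rcases (eq_of_mem_hitting (hD hd)).2 with h | h
    · exact Finset.mem_union_left _ (Finset.mem_image.2 ⟨_, hT d hd, h.symm⟩)
    · exact Finset.mem_union_right _ (Finset.mem_image.2 ⟨_, hT d hd, h.symm⟩)
  have h1 := Finset.card_le_card hsub
  have h2 := Finset.card_union_le (T.image (fun v => (w.negate, v)))
    (T.image (fun v => (v, w.negate)))
  have h3 := Finset.card_image_le (s := T) (f := fun v => (w.negate, v))
  have h4 := Finset.card_image_le (s := T) (f := fun v => (v, w.negate))
  omega

theorem card_hitting_le {n : ℕ} (S : Finset (Lit (Fin n))) (w : Lit (Fin n)) :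
    (hitting S w).card ≤ 4 * (n - 1) := by
  have := card_le_of_implied_mem (S := S) (w := w) (Finset.Subset.refl _)
    (T := Finset.univ.filter fun v : Lit (Fin n) => v.2 ≠ w.2)
    (fun d hd => by simpa using (eq_of_mem_hitting hd).1)
  rw [card_filter_snd_ne] at this
  omega

theorem card_hitting_not_isFresh_le {n : ℕ} (S W : Finset (Lit (Fin n))) (w : Lit (Fin n)) :
    ((hitting S w).filter fun d => ¬ IsFresh W (implied w d)).card ≤ 4 * W.card := by
  have := card_le_of_implied_mem (S := S) (w := w) (T := symClosure W)
    (Finset.filter_subset (fun d => ¬ IsFresh W (implied w d)) _) (fun d hd => by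
      have := (Finset.mem_filter.1 hd).2
      unfold IsFresh at this
      push Not at this
      exact mem_symClosure.2 this)
  have := card_symClosure_le W
  omega

theorem card_avoiding_empty (n : ℕ) :
    (avoiding (∅ : Finset (Lit (Fin n)))).card = 4 * n * (n - 1) := by
  have h : avoiding (∅ : Finset (Lit (Fin n))) = ((Finset.univ : Finset (Lit (Fin n))).sigma
      (fun u => Finset.univ.filter fun v : Lit (Fin n) => v.2 ≠ u.2)).image
        (fun p => (p.1, p.2)) := by
    ext d
    simp only [avoiding, Finset.mem_filter, Finset.mem_univ, true_and, Finset.notMem_empty,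
      not_false_eq_true, and_true, Finset.mem_image, Finset.mem_sigma]
    refine ⟨fun h => ⟨⟨d.1, d.2⟩, h.symm, rfl⟩, ?_⟩
    rintro ⟨⟨a, b⟩, h, rfl⟩
    exact h.symm
  rw [h, Finset.card_image_of_injective, Finset.card_sigma]
  · simp only [card_filter_snd_ne]
    simp
    ring
  · rintro ⟨a, b⟩ ⟨c, d⟩ h
    simpa using h

theorem le_card_avoiding {n : ℕ} (S : Finset (Lit (Fin n))) :
    4 * n * (n - 1) ≤ (avoiding S).card + S.card * (4 * (n - 1)) := by
  induction S using Finset.induction_on with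
  | empty => simp [card_avoiding_empty]
  | insert w S hw ih =>
    have h1 := card_avoiding S w
    have h2 := card_hitting_le S w
    rw [Finset.card_insert_of_notMem hw, add_mul, one_mul]
    omega

theorem unexplored_union_le {n m : ℕ} (W X : Finset (Lit (Fin n)))
    (S : Fin m → Finset (Lit (Fin n))) :
    unexplored (W ∪ X) S ≤ unexplored W S + m * X.card := by
  unfold unexplored
  have : m * X.card = ∑ _i : Fin m, X.card := by simp
  rw [this, ← Finset.sum_add_distrib]
  refine Finset.sum_le_sum fun i _ => ?_
  rw [Finset.union_sdiff_distrib]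
  exact (Finset.card_union_le _ _).trans
    (Nat.add_le_add_left (Finset.card_le_card Finset.sdiff_subset) _)

theorem unexplored_update_lt {n m : ℕ} {W : Finset (Lit (Fin n))}
    {S : Fin m → Finset (Lit (Fin n))} {i : Fin m} {s : Finset (Lit (Fin n))} {w : Lit (Fin n)}
    (hw : w ∈ W) (hwS : w ∉ S i) (hs : insert w (S i) ⊆ s) :
    unexplored W (Function.update S i s) < unexplored W S := by
  have hsub : W \ s ⊂ W \ S i := by
    refine Finset.ssubset_iff_of_subset
      (Finset.sdiff_subset_sdiff (Finset.Subset.refl _) ((Finset.subset_insert _ _).trans hs)) |>.2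
      ⟨w, Finset.mem_sdiff.2 ⟨hw, hwS⟩, fun h => (Finset.mem_sdiff.1 h).2 (hs ?_)⟩
    exact Finset.mem_insert_self _ _
  refine Finset.sum_lt_sum (fun j _ => ?_) ⟨i, Finset.mem_univ _, ?_⟩
  · by_cases h : j = i
    · subst h
      simpa using Finset.card_le_card hsub.1
    · simp [h]
  · simpa using Finset.card_lt_card hsub

theorem not_largeClosure_of_unexplored_eq_zero {n m K : ℕ} {W₀ W : Finset (Lit (Fin n))}
    {Q : Fin m → Finset (Clause (Fin n))} {S : Fin m → Finset (Lit (Fin n))}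
    (hQ : ∀ i, ClauseState W (Q i) (S i)) (hW : W₀ ⊆ W) (hK : W.card < K)
    (h0 : unexplored W S = 0) {f : FSpace n m} (hf : f ∈ Fintype.piFinset Q) :
    ¬ LargeClosure K W₀ f := by
  intro h
  refine absurd (h W hW ?_) (not_le.2 hK)
  intro c hc
  obtain ⟨i, rfl⟩ := (List.mem_ofFn' _ _).1 hc
  have hfi := Fintype.mem_piFinset.1 hf i
  have hWS : W ⊆ S i := by
    have := (Finset.sum_eq_zero_iff.1 h0) i (Finset.mem_univ _)
    rwa [Finset.card_eq_zero, Finset.sdiff_eq_empty_iff_subset] at this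
  rcases hQ i with ⟨hq, -⟩ | ⟨d, hq, -, hd⟩
  · rw [hq] at hfi
    have := (Finset.mem_filter.1 hfi).2.2
    exact ⟨fun h => absurd (hWS h) this.1, fun h => absurd (hWS h) this.2⟩
  · rw [hq] at hfi
    rw [Finset.mem_singleton.1 hfi]
    exact hd.2

/-- Constants for which the weight of an exploration does not increase on average: `x c` is the
weight of a literal and `b c` that of an unexplored pair after `c` collisions, `t c` bounds the
weight of a newly reached literal, and `Y` is the weight of a collision. -/
structure Weights (n m K : ℕ) where
  x : ℕ → ℝ
  b : ℕ → ℝ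
  t : ℕ → ℝ
  Y : ℝ
  ε : ℝ
  one_le_x : ∀ c, 1 ≤ x c
  one_le_b : ∀ c, 1 ≤ b c
  one_le_Y : 1 ≤ Y
  ε_nonneg : 0 ≤ ε
  literal_le : ∀ c, x c * b c ^ m ≤ t c
  collision_le : ∀ c, x (c + 1) ^ 2 * b (c + 1) ^ m ≤ x c
  b_succ_le : ∀ c, b (c + 1) ≤ b c
  drift_le : ∀ c < 4, 4 * ((n : ℝ) - 1) * (t c - 1) + 4 * K * Y ≤
    (b c - 1) * (4 * ((n : ℝ) - 1) * ((n : ℝ) - K))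
  one_le_size : ∀ c < 4, 1 ≤ ε * x c ^ K
  one_le_collisions : 1 ≤ ε * Y ^ 4

namespace Weights

variable {n m K : ℕ}

/-- The weight of a state with `w` reached literals, `r` unexplored pairs and `c` collisions. -/
def weight (p : Weights n m K) (c w r : ℕ) : ℝ := p.Y ^ c * p.x c ^ w * p.b c ^ r

theorem weight_nonneg (p : Weights n m K) (c w r : ℕ) : 0 ≤ p.weight c w r := by
  have h1 := p.one_le_x c
  have h2 := p.one_le_b c
  have h3 := p.one_le_Y
  unfold weight
  positivity

theorem weight_mono (p : Weights n m K) (c : ℕ) {w w' r r' : ℕ} (hw : w ≤ w') (hr : r ≤ r') :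
    p.weight c w r ≤ p.weight c w' r' := by
  have h1 := p.one_le_x c
  have h2 := p.one_le_b c
  have h3 := p.one_le_Y
  unfold weight
  gcongr

theorem weight_succ_pair (p : Weights n m K) (c w r : ℕ) :
    p.weight c w (r + 1) = p.weight c w r * p.b c := by
  unfold weight
  ring

theorem weight_literal_le (p : Weights n m K) (c w r : ℕ) :
    p.weight c (w + 1) (r + m) ≤ p.weight c w r * p.t c := by
  have : p.weight c (w + 1) (r + m) = p.weight c w r * (p.x c * p.b c ^ m) := by
    unfold weight
    ring
  rw [this]
  exact mul_le_mul_of_nonneg_left (p.literal_le c) (p.weight_nonneg c w r)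

theorem weight_collision_le (p : Weights n m K) (c w r : ℕ) :
    p.weight (c + 1) (2 * w) (r + m * w) ≤ p.weight c w r * p.Y := by
  have h1 := p.one_le_x (c + 1)
  have h2 := p.one_le_b (c + 1)
  have h3 := p.one_le_Y
  have h4 := p.one_le_x c
  calc p.weight (c + 1) (2 * w) (r + m * w)
      = p.Y ^ c * (p.x (c + 1) ^ 2 * p.b (c + 1) ^ m) ^ w * p.b (c + 1) ^ r * p.Y := by
        unfold weight
        ring
    _ ≤ p.Y ^ c * p.x c ^ w * p.b c ^ r * p.Y := by
        have := p.collision_le c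
        have := p.b_succ_le c
        gcongr

theorem one_le_of_large (p : Weights n m K) {c w : ℕ} (r : ℕ) (hc : c < 4) (hw : K ≤ w) :
    1 ≤ p.ε * p.weight c w r := by
  have h1 := p.one_le_x c
  have h2 := p.one_le_b c
  have h3 := p.one_le_Y
  refine (p.one_le_size c hc).trans (mul_le_mul_of_nonneg_left ?_ p.ε_nonneg)
  calc p.x c ^ K ≤ p.x c ^ w := pow_le_pow_right₀ h1 hw
    _ = 1 * p.x c ^ w * 1 := by ring
    _ ≤ p.weight c w r := by
        unfold weight
        gcongr
        · exact one_le_pow₀ h3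
        · exact one_le_pow₀ h2

theorem one_le_of_collisions (p : Weights n m K) (w r : ℕ) : 1 ≤ p.ε * p.weight 4 w r := by
  have h1 := p.one_le_x 4
  have h2 := p.one_le_b 4
  have h3 := p.one_le_Y
  refine p.one_le_collisions.trans (mul_le_mul_of_nonneg_left ?_ p.ε_nonneg)
  calc p.Y ^ 4 = p.Y ^ 4 * 1 * 1 := by ring
    _ ≤ p.weight 4 w r := by
        unfold weight
        gcongr
        · exact one_le_pow₀ h1
        · exact one_le_pow₀ h2

/-- Exploring whether a clause contains `¬ w` does not increase the weight on average. -/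
theorem average_le (p : Weights n m K) {c : ℕ} (hc : c < 4) (hn : 2 ≤ n)
    {s W : Finset (Lit (Fin n))} (w : Lit (Fin n)) (hs : s ⊆ W) (hW : W.card < K) :
    ((avoiding (insert w s)).card : ℝ) +
        (((hitting s w).filter fun d => IsFresh W (implied w d)).card : ℝ) * p.t c +
        (((hitting s w).filter fun d => ¬ IsFresh W (implied w d)).card : ℝ) * p.Y ≤
      p.b c * (avoiding s).card := by
  have hb := p.one_le_b c
  have hY := p.one_le_Y
  have ht : 1 ≤ p.t c := (one_le_mul_of_one_le_of_one_le (p.one_le_x c)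
    (one_le_pow₀ hb)).trans (p.literal_le c)
  have hd := p.drift_le c hc
  have h1 : ((avoiding s).card : ℝ) = (avoiding (insert w s)).card + (hitting s w).card := by
    exact_mod_cast card_avoiding s w
  have h2 : ((hitting s w).card : ℝ) =
      ((hitting s w).filter fun d => IsFresh W (implied w d)).card +
      ((hitting s w).filter fun d => ¬ IsFresh W (implied w d)).card := by
    exact_mod_cast (Finset.card_filter_add_card_filter_not _).symm
  have hn1 : ((n - 1 : ℕ) : ℝ) = (n : ℝ) - 1 := by
    rw [Nat.cast_sub (by omega), Nat.cast_one]
  have hn0 : (0 : ℝ) ≤ (n : ℝ) - 1 := hn1 ▸ Nat.cast_nonneg _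
  have h3 : ((hitting s w).card : ℝ) ≤ 4 * ((n : ℝ) - 1) := by
    rw [← hn1]
    exact_mod_cast card_hitting_le s w
  have h4 : (((hitting s w).filter fun d => ¬ IsFresh W (implied w d)).card : ℝ) ≤ 4 * K := by
    exact_mod_cast (card_hitting_not_isFresh_le s W w).trans (by omega)
  have h5 : 4 * ((n : ℝ) - 1) * ((n : ℝ) - K) ≤ (avoiding s).card := by
    have h : 4 * (n : ℝ) * ((n : ℝ) - 1) ≤
        (avoiding s).card + (s.card : ℝ) * (4 * ((n : ℝ) - 1)) := by
      rw [← hn1]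
      exact_mod_cast le_card_avoiding s
    have hsK : (s.card : ℝ) ≤ K := by
      exact_mod_cast (Finset.card_le_card hs).trans hW.le
    nlinarith [mul_le_mul_of_nonneg_right hsK hn0]
  generalize (((hitting s w).filter fun d => IsFresh W (implied w d)).card : ℝ) = e at *
  have he : (0 : ℝ) ≤ ((hitting s w).filter fun d => ¬ IsFresh W (implied w d)).card :=
    Nat.cast_nonneg _
  generalize (((hitting s w).filter fun d => ¬ IsFresh W (implied w d)).card : ℝ) = e' at *
  have h6 : (p.b c - 1) * (4 * ((n : ℝ) - 1) * ((n : ℝ) - K)) ≤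
      (p.b c - 1) * (avoiding s).card := mul_le_mul_of_nonneg_left h5 (by linarith)
  have h7 : (e + e') * (p.t c - 1) ≤ 4 * ((n : ℝ) - 1) * (p.t c - 1) :=
    mul_le_mul_of_nonneg_right (by linarith) (by linarith)
  have h8 : e' * p.Y ≤ 4 * K * p.Y := mul_le_mul_of_nonneg_right h4 (by linarith)
  nlinarith [mul_nonneg he (sub_nonneg.2 ht)]

end Weights

/-- Splitting the set of values of one coordinate bounds a count over a product. -/
theorem card_filter_piFinset_le {ι β : Type*} [Fintype ι] [DecidableEq ι]
    (Q : ι → Finset β) (i : ι) (q e : Finset β) (h : ∀ a ∈ Q i, a ∈ q ∨ a ∈ e) (P : (ι → β) → Prop) :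
    ((Fintype.piFinset Q).filter P).card ≤
      ((Fintype.piFinset (Function.update Q i q)).filter P).card +
      ∑ d ∈ e, ((Fintype.piFinset (Function.update Q i {d})).filter P).card := by
  have hsub : (Fintype.piFinset Q).filter P ⊆
      (Fintype.piFinset (Function.update Q i q)).filter P ∪
        e.biUnion fun d => (Fintype.piFinset (Function.update Q i {d})).filter P := by
    intro f hf
    obtain ⟨hf, hP⟩ := Finset.mem_filter.1 hf
    have hf := Fintype.mem_piFinset.1 hf
    have key : ∀ s : Finset β, f i ∈ s →
        f ∈ (Fintype.piFinset (Function.update Q i s)).filter P := by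
      intro s hs
      refine Finset.mem_filter.2 ⟨Fintype.mem_piFinset.2 fun j => ?_, hP⟩
      by_cases hj : j = i
      · subst hj
        simpa using hs
      · simpa [hj] using hf j
    rcases h _ (hf i) with h | h
    · exact Finset.mem_union_left _ (key q h)
    · exact Finset.mem_union_right _
        (Finset.mem_biUnion.2 ⟨f i, h, key _ (Finset.mem_singleton_self _)⟩)
  exact (Finset.card_le_card hsub).trans ((Finset.card_union_le _ _).trans
    (Nat.add_le_add_left Finset.card_biUnion_le _))

theorem prod_card_update {ι β : Type*} [Fintype ι] [DecidableEq ι]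
    (Q : ι → Finset β) (i : ι) (q : Finset β) :
    ∏ j, ((Function.update Q i q j).card : ℝ) =
      q.card * ∏ j ∈ Finset.univ \ {i}, ((Q j).card : ℝ) := by
  rw [← Finset.prod_sdiff (Finset.subset_univ {i}), mul_comm, Finset.prod_singleton,
    Function.update_self]
  congr 1
  refine Finset.prod_congr rfl fun j hj => ?_
  rw [Function.update_of_ne (by simpa using hj)]

/-- The number of formulas consistent with a state of the exploration whose closure is large is
at most a fraction of all consistent formulas determined by the weight of the state. -/
theorem card_largeClosure_le {n m K : ℕ} (p : Weights n m K) (hn : 2 ≤ n)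
    (W₀ : Finset (Lit (Fin n))) (N : ℕ) :
    ∀ (c : ℕ) (W : Finset (Lit (Fin n))) (Q : Fin m → Finset (Clause (Fin n)))
      (S : Fin m → Finset (Lit (Fin n))), c ≤ 4 → W₀ ⊆ W →
      (∀ i, ClauseState W (Q i) (S i)) → unexplored Finset.univ S ≤ N →
      (((Fintype.piFinset Q).filter (LargeClosure K W₀)).card : ℝ) ≤
        p.ε * p.weight c W.card (unexplored W S) * ∏ i, ((Q i).card : ℝ) := by
  induction N using Nat.strong_induction_on with
  | _ N ih =>
  intro c W Q S hc hW hQ hN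
  have hprod : (0 : ℝ) ≤ ∏ i, ((Q i).card : ℝ) := Finset.prod_nonneg fun _ _ => Nat.cast_nonneg _
  have htriv : 1 ≤ p.ε * p.weight c W.card (unexplored W S) →
      (((Fintype.piFinset Q).filter (LargeClosure K W₀)).card : ℝ) ≤
        p.ε * p.weight c W.card (unexplored W S) * ∏ i, ((Q i).card : ℝ) := by
    intro h
    calc (((Fintype.piFinset Q).filter (LargeClosure K W₀)).card : ℝ)
        ≤ (Fintype.piFinset Q).card := by exact_mod_cast Finset.card_filter_le _ _
      _ = 1 * ∏ i, ((Q i).card : ℝ) := by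
          rw [Fintype.card_piFinset]
          push_cast
          ring
      _ ≤ _ := mul_le_mul_of_nonneg_right h hprod
  rcases hc.eq_or_lt with rfl | hc
  · exact htriv (p.one_le_of_collisions _ _)
  rcases le_or_gt K W.card with hK | hK
  · exact htriv (p.one_le_of_large _ hc hK)
  rcases Nat.eq_zero_or_pos (unexplored W S) with h0 | h0
  · rw [Finset.filter_false_of_mem fun f hf =>
      not_largeClosure_of_unexplored_eq_zero hQ hW hK h0 hf]
    rw [Finset.card_empty, Nat.cast_zero]
    exact mul_nonneg (mul_nonneg p.ε_nonneg (p.weight_nonneg _ _ _)) hprod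
  obtain ⟨i, -, hi⟩ := Finset.exists_ne_zero_of_sum_ne_zero h0.ne'
  obtain ⟨w, hw⟩ := Finset.card_ne_zero.1 hi
  obtain ⟨hwW, hwS⟩ := Finset.mem_sdiff.1 hw
  obtain ⟨hQi, hSi⟩ : Q i = avoiding (S i) ∧ S i ⊆ W := by
    rcases hQ i with h | ⟨d, -, h, -⟩
    · exact h
    · exact absurd (h ▸ Finset.mem_univ w) hwS
  have hclause : ∀ (W' : Finset (Lit (Fin n))) (q : Finset (Clause (Fin n)))
      (s : Finset (Lit (Fin n))), (∀ j, ClauseState W' (Q j) (S j)) → ClauseState W' q s →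
      ∀ j, ClauseState W' (Function.update Q i q j) (Function.update S i s j) := by
    intro W' q s h h' j
    rcases eq_or_ne j i with rfl | hj
    · rw [Function.update_self, Function.update_self]
      exact h'
    · rw [Function.update_of_ne hj, Function.update_of_ne hj]
      exact h j
  obtain ⟨r, hr⟩ : ∃ r, unexplored W S = r + 1 := ⟨_, (Nat.succ_pred_eq_of_pos h0).symm⟩
  have hdec : ∀ s, insert w (S i) ⊆ s → unexplored W (Function.update S i s) ≤ r := by
    intro s hs
    have := unexplored_update_lt hwW hwS hs
    omega
  have hdecN : ∀ s, insert w (S i) ⊆ s →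
      unexplored Finset.univ (Function.update S i s) < N := fun s hs =>
    (unexplored_update_lt (Finset.mem_univ w) hwS hs).trans_le hN
  set T : ℝ := ∏ j ∈ Finset.univ \ {i}, ((Q j).card : ℝ) with hT
  have hT0 : 0 ≤ T := Finset.prod_nonneg fun _ _ => Nat.cast_nonneg _
  have hQprod : ∏ j, ((Q j).card : ℝ) = (avoiding (S i)).card * T := by
    have := prod_card_update Q i (Q i)
    rwa [Function.update_eq_self, hQi] at this
  have hrest : (((Fintype.piFinset (Function.update Q i (avoiding (insert w (S i))))).filter
      (LargeClosure K W₀)).card : ℝ) ≤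
      p.ε * p.weight c W.card r * ((avoiding (insert w (S i))).card * T) := by
    refine (ih _ (hdecN _ (Finset.Subset.refl _)) c W _ _ hc.le hW
      (hclause W _ _ hQ (Or.inl ⟨rfl, Finset.insert_subset hwW hSi⟩)) le_rfl).trans ?_
    rw [prod_card_update]
    exact mul_le_mul_of_nonneg_right (mul_le_mul_of_nonneg_left
      (p.weight_mono c le_rfl (hdec _ (Finset.Subset.refl _))) p.ε_nonneg)
      (mul_nonneg (Nat.cast_nonneg _) hT0)
  have hfresh : ∀ d ∈ (hitting (S i) w).filter fun d => IsFresh W (implied w d),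
      (((Fintype.piFinset (Function.update Q i {d})).filter (LargeClosure K W₀)).card : ℝ) ≤
      p.ε * (p.weight c W.card r * p.t c) * T := by
    intro d hd
    obtain ⟨hd, hf⟩ := Finset.mem_filter.1 hd
    refine (ih _ (hdecN _ (Finset.subset_univ _)) c (insert (implied w d) W) _ _ hc.le
      (hW.trans (Finset.subset_insert _ _)) (hclause _ _ _ (fun j => (hQ j).insert hf)
      (Or.inr ⟨d, rfl, rfl, settled_insert_implied hwW hd hf⟩)) le_rfl).trans ?_
    rw [prod_card_update, Finset.card_singleton, Nat.cast_one, one_mul]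
    refine mul_le_mul_of_nonneg_right (mul_le_mul_of_nonneg_left ?_ p.ε_nonneg) hT0
    refine le_trans (p.weight_mono c (Finset.card_insert_le _ _) ?_) (p.weight_literal_le c _ _)
    have h := unexplored_union_le W {implied w d} (Function.update S i Finset.univ)
    rw [Finset.union_comm, ← Finset.insert_eq, Finset.card_singleton] at h
    have := hdec _ (Finset.subset_univ _)
    omega
  have hcoll : ∀ d ∈ (hitting (S i) w).filter fun d => ¬ IsFresh W (implied w d),
      (((Fintype.piFinset (Function.update Q i {d})).filter (LargeClosure K W₀)).card : ℝ) ≤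
      p.ε * (p.weight c W.card r * p.Y) * T := by
    intro d hd
    obtain ⟨hd, hf⟩ := Finset.mem_filter.1 hd
    refine (ih _ (hdecN _ (Finset.subset_univ _)) (c + 1) (symClosure W) _ _ hc
      (hW.trans Finset.subset_union_left) (hclause _ _ _ (fun j => (hQ j).symClosure)
      (Or.inr ⟨d, rfl, rfl, settled_symClosure_of_not_isFresh hwW hd hf⟩)) le_rfl).trans ?_
    rw [prod_card_update, Finset.card_singleton, Nat.cast_one, one_mul]
    refine mul_le_mul_of_nonneg_right (mul_le_mul_of_nonneg_left ?_ p.ε_nonneg) hT0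
    refine le_trans (p.weight_mono _ (card_symClosure_le W) ?_) (p.weight_collision_le c _ _)
    refine (unexplored_union_le _ _ _).trans ?_
    exact Nat.add_le_add (hdec _ (Finset.subset_univ _))
      (Nat.mul_le_mul_left _ Finset.card_image_le)
  have hsplit := card_filter_piFinset_le Q i (avoiding (insert w (S i))) (hitting (S i) w)
    (fun a ha => Finset.mem_union.1 (avoiding_eq_union (S i) w ▸ hQi ▸ ha)) (LargeClosure K W₀)
  rw [← Finset.sum_filter_add_sum_filter_not _ (fun d => IsFresh W (implied w d))] at hsplit
  have hsum1 := Finset.sum_le_sum hfresh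
  have hsum2 := Finset.sum_le_sum hcoll
  rw [Finset.sum_const, nsmul_eq_mul] at hsum1 hsum2
  have havg := p.average_le hc hn w hSi hK
  have hG : 0 ≤ p.ε * p.weight c W.card r * T :=
    mul_nonneg (mul_nonneg p.ε_nonneg (p.weight_nonneg _ _ _)) hT0
  have hfin := mul_le_mul_of_nonneg_left havg hG
  have hsplit' := (Nat.cast_le (α := ℝ)).2 hsplit
  push_cast at hsplit'
  rw [hr, p.weight_succ_pair, hQprod]
  linarith

theorem ncard_ucpVars_le {n : ℕ} {Φ : CNF (Fin n)} {W : Finset (Lit (Fin n))} {l : Lit (Fin n)}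
    (hl : l ∈ W) (hW : ucpClosed Φ (W : Set (Lit (Fin n)))) :
    (ucpVars Φ l).ncard ≤ W.card := by
  have hsub : ucpVars Φ l ⊆ ((W.image Prod.snd : Finset (Fin n)) : Set (Fin n)) := by
    rw [Finset.coe_image]
    exact Set.image_mono (Set.sInter_subset_of_mem ⟨hl, hW⟩)
  calc (ucpVars Φ l).ncard ≤ ((W.image Prod.snd : Finset (Fin n)) : Set (Fin n)).ncard :=
        Set.ncard_le_ncard hsub (Finset.finite_toSet _)
    _ = (W.image Prod.snd).card := Set.ncard_coe_finset _
    _ ≤ W.card := Finset.card_image_le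

theorem validFormulas_eq_piFinset (n m : ℕ) :
    validFormulas n m = Fintype.piFinset fun _ : Fin m => avoiding (∅ : Finset (Lit (Fin n))) := by
  ext f
  simp [validFormulas, avoiding, Fintype.mem_piFinset]

/-- The literals over the variable `i`. -/
def bothLits {n : ℕ} (i : Fin n) : Finset (Lit (Fin n)) := {(true, i), (false, i)}

theorem card_filter_largeClosure_le {n m K : ℕ} (p : Weights n m K) (hn : 2 ≤ n) (i : Fin n) :
    (((validFormulas n m).filter (LargeClosure K (bothLits i))).card : ℝ) ≤
      p.ε * p.t 0 ^ 2 * (validFormulas n m).card := by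
  have h := card_largeClosure_le p hn (bothLits i) _ 0 (bothLits i)
    (fun _ => avoiding ∅) (fun _ => ∅) (Nat.zero_le _) (Finset.Subset.refl _)
    (fun _ => Or.inl ⟨rfl, Finset.empty_subset _⟩) le_rfl
  have hcard : (bothLits i).card = 2 := by
    unfold bothLits
    exact Finset.card_pair (by simp)
  have hun : unexplored (bothLits i) (fun _ : Fin m => ∅) = 2 * m := by
    simp [unexplored, hcard, mul_comm]
  have hw : p.weight 0 2 (2 * m) ≤ p.t 0 ^ 2 := by
    have h0 : p.weight 0 2 (2 * m) = (p.x 0 * p.b 0 ^ m) ^ 2 := by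
      unfold Weights.weight
      ring
    have h1 := p.one_le_x 0
    have h2 := p.one_le_b 0
    rw [h0]
    exact pow_le_pow_left₀ (by positivity) (p.literal_le 0) 2
  rw [hcard, hun] at h
  have hprod : ((validFormulas n m).card : ℝ) =
      ∏ _i : Fin m, ((avoiding (∅ : Finset (Lit (Fin n)))).card : ℝ) := by
    rw [validFormulas_eq_piFinset, Fintype.card_piFinset]
    push_cast
    rfl
  rw [hprod, validFormulas_eq_piFinset]
  refine h.trans (mul_le_mul_of_nonneg_right (mul_le_mul_of_nonneg_left hw p.ε_nonneg) ?_)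
  exact Finset.prod_nonneg fun _ _ => Nat.cast_nonneg _

theorem one_sub_prF {n m : ℕ} (hn : 2 ≤ n) (P : FSpace n m → Prop) :
    1 - prF n m P =
      (((validFormulas n m).filter fun f => ¬ P f).card : ℝ) / (validFormulas n m).card := by
  have hpos : (0 : ℝ) < (validFormulas n m).card := by
    rw [validFormulas_eq_piFinset, Fintype.card_piFinset_const, card_avoiding_empty]
    have : 0 < 4 * n * (n - 1) := Nat.mul_pos (by omega) (by omega)
    positivity
  have h : (((validFormulas n m).filter P).card : ℝ) +
      ((validFormulas n m).filter fun f => ¬ P f).card = (validFormulas n m).card := by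
    exact_mod_cast Finset.card_filter_add_card_filter_not _
  unfold prF
  rw [eq_div_iff hpos.ne', sub_mul, div_mul_cancel₀ _ hpos.ne']
  linarith

/-- The failure probability is bounded in terms of the weights of an exploration. -/
theorem one_sub_prF_le {n m K : ℕ} {B : ℝ} (p : Weights n m K) (hn : 2 ≤ n)
    (hB : ∀ w < K, 2 * (w : ℝ) ≤ B) :
    1 - prF n m (fun f => ∀ i : Fin n, (((ucpVars (toCNF f) (true, i)).ncard : ℝ) +
        ((ucpVars (toCNF f) (false, i)).ncard : ℝ)) ≤ B) ≤ n * (p.ε * p.t 0 ^ 2) := by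
  rw [one_sub_prF hn]
  refine div_le_of_le_mul₀ (Nat.cast_nonneg _)
    (mul_nonneg (Nat.cast_nonneg _) (mul_nonneg p.ε_nonneg (sq_nonneg _))) ?_
  have hsub : ((validFormulas n m).filter fun f => ¬ ∀ i : Fin n,
      (((ucpVars (toCNF f) (true, i)).ncard : ℝ) +
        ((ucpVars (toCNF f) (false, i)).ncard : ℝ)) ≤ B) ⊆
      Finset.univ.biUnion fun i => (validFormulas n m).filter (LargeClosure K (bothLits i)) := by
    intro f hf
    obtain ⟨hf, hbad⟩ := Finset.mem_filter.1 hf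
    push Not at hbad
    obtain ⟨i, hi⟩ := hbad
    refine Finset.mem_biUnion.2 ⟨i, Finset.mem_univ _, Finset.mem_filter.2 ⟨hf, ?_⟩⟩
    intro W hW hcl
    by_contra! hK
    have h1 : ((ucpVars (toCNF f) (true, i)).ncard : ℝ) ≤ W.card :=
      Nat.cast_le.2 (ncard_ucpVars_le (hW (by simp [bothLits])) hcl)
    have h2 : ((ucpVars (toCNF f) (false, i)).ncard : ℝ) ≤ W.card :=
      Nat.cast_le.2 (ncard_ucpVars_le (hW (by simp [bothLits])) hcl)
    linarith [hB _ hK]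
  have h1 := (Nat.cast_le (α := ℝ)).2 ((Finset.card_le_card hsub).trans Finset.card_biUnion_le)
  refine le_trans (le_of_eq (by congr!)) (h1.trans ?_)
  push_cast
  refine (Finset.sum_le_sum fun i _ => card_filter_largeClosure_le p hn i).trans ?_
  rw [Finset.sum_const, Finset.card_univ, Fintype.card_fin, nsmul_eq_mul, ← mul_assoc]

/-- The exponential rate of a reached literal after `c` collisions. -/
noncomputable def literalRate (γ : ℝ) (c : ℕ) : ℝ := γ * (γ / 2) ^ c

theorem literalRate_pos {γ : ℝ} (hγ : 0 < γ) (c : ℕ) : 0 < literalRate γ c := by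
  unfold literalRate
  positivity

theorem literalRate_anti {γ : ℝ} (hγ : 0 < γ) (hγ1 : γ ≤ 1) : Antitone (literalRate γ) := by
  intro a b hab
  exact mul_le_mul_of_nonneg_left
    (pow_le_pow_of_le_one (by positivity) (by linarith) hab) hγ.le

theorem exists_weights {n m K : ℕ} {γ η : ℝ} (hγ : 0 < γ) (hγ1 : γ ≤ 1) (hm : 0 < m) (hn : 2 ≤ n)
    (hK : 0 < K) (hη : (K : ℝ) ≤ η * n)
    (hdrift : ∀ c < 4, Real.exp (literalRate γ c) - 1 + η * (n / ((n : ℝ) - 1)) ≤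
      literalRate γ c * (1 - γ) * (((n : ℝ) - K) / m)) :
    ∃ p : Weights n m K, p.t 0 = Real.exp γ ∧
      p.ε = ((K : ℝ) / (η * n)) ^ 4 + Real.exp (-(γ * literalRate γ 3 * K)) := by
  have hm' : (0 : ℝ) < m := Nat.cast_pos.2 hm
  have hK' : (0 : ℝ) < K := Nat.cast_pos.2 hK
  have hηn : 0 < η * n := hK'.trans_le hη
  have hn1 : (0 : ℝ) < (n : ℝ) - 1 := by
    have : (2 : ℝ) ≤ n := by exact_mod_cast hn
    linarith
  have hθ := literalRate_pos hγ
  have hρ : ∀ c, 0 ≤ literalRate γ c * (1 - γ) / m := fun c =>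
    div_nonneg (mul_nonneg (hθ c).le (by linarith)) hm'.le
  have hpow : ∀ c, (1 + literalRate γ c * (1 - γ) / m) ^ m ≤
      Real.exp (literalRate γ c * (1 - γ)) := by
    intro c
    calc (1 + literalRate γ c * (1 - γ) / m) ^ m
        ≤ Real.exp (literalRate γ c * (1 - γ) / m) ^ m := by
          refine pow_le_pow_left₀ (by linarith [hρ c]) ?_ m
          linarith [Real.add_one_le_exp (literalRate γ c * (1 - γ) / m)]
      _ = Real.exp (literalRate γ c * (1 - γ)) := by
          rw [← Real.exp_nat_mul, mul_div_cancel₀ _ hm'.ne']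
  refine ⟨{
    x := fun c => Real.exp (γ * literalRate γ c)
    b := fun c => 1 + literalRate γ c * (1 - γ) / m
    t := fun c => Real.exp (literalRate γ c)
    Y := η * n / K
    ε := ((K : ℝ) / (η * n)) ^ 4 + Real.exp (-(γ * literalRate γ 3 * K))
    one_le_x := fun c => Real.one_le_exp (mul_pos hγ (hθ c)).le
    one_le_b := fun c => by linarith [hρ c]
    one_le_Y := (one_le_div hK').2 hη
    ε_nonneg := by positivity
    literal_le := fun c => ?_
    collision_le := fun c => ?_
    b_succ_le := fun c => ?_
    drift_le := fun c hc => ?_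
    one_le_size := fun c hc => ?_
    one_le_collisions := ?_ }, ?_, rfl⟩
  · calc Real.exp (γ * literalRate γ c) * (1 + literalRate γ c * (1 - γ) / m) ^ m
        ≤ Real.exp (γ * literalRate γ c) * Real.exp (literalRate γ c * (1 - γ)) :=
          mul_le_mul_of_nonneg_left (hpow c) (Real.exp_pos _).le
      _ = Real.exp (literalRate γ c) := by
          rw [← Real.exp_add]
          ring_nf
  · have hstep : literalRate γ (c + 1) = literalRate γ c * (γ / 2) := by
      unfold literalRate
      ring
    calc Real.exp (γ * literalRate γ (c + 1)) ^ 2 *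
          (1 + literalRate γ (c + 1) * (1 - γ) / m) ^ m
        ≤ Real.exp (γ * literalRate γ (c + 1)) ^ 2 *
          Real.exp (literalRate γ (c + 1) * (1 - γ)) :=
          mul_le_mul_of_nonneg_left (hpow _) (by positivity)
      _ = Real.exp (literalRate γ (c + 1) * (1 + γ)) := by
          rw [← Real.exp_nat_mul, ← Real.exp_add]
          push_cast
          ring_nf
      _ ≤ Real.exp (γ * literalRate γ c) := by
          refine Real.exp_le_exp.2 ?_
          rw [hstep]
          nlinarith [mul_pos hγ (hθ c)]
  · have := literalRate_anti hγ hγ1 (Nat.le_succ c)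
    have h1 : 0 ≤ 1 - γ := by linarith
    gcongr
  · have h := mul_le_mul_of_nonneg_left (hdrift c hc) (by positivity : 0 ≤ 4 * ((n : ℝ) - 1))
    calc 4 * ((n : ℝ) - 1) * (Real.exp (literalRate γ c) - 1) + 4 * K * (η * n / K)
        = 4 * ((n : ℝ) - 1) * (Real.exp (literalRate γ c) - 1 + η * (n / ((n : ℝ) - 1))) := by
          field_simp
      _ ≤ _ := h
      _ = _ := by
          field_simp
          ring
  · have h3 : literalRate γ 3 ≤ literalRate γ c := literalRate_anti hγ hγ1 (by omega)
    calc (1 : ℝ) = Real.exp (-(γ * literalRate γ 3 * K)) *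
          Real.exp (γ * literalRate γ 3 * K) := by
          rw [← Real.exp_add, neg_add_cancel, Real.exp_zero]
      _ ≤ (((K : ℝ) / (η * n)) ^ 4 + Real.exp (-(γ * literalRate γ 3 * K))) *
          Real.exp (γ * literalRate γ c) ^ K := by
          rw [← Real.exp_nat_mul]
          have h4 : 0 ≤ ((K : ℝ) / (η * n)) ^ 4 := by positivity
          refine mul_le_mul (by linarith) (Real.exp_le_exp.2 ?_) (Real.exp_pos _).le
            (by positivity)
          nlinarith [mul_le_mul_of_nonneg_left h3 (mul_pos hγ hK').le]
  · calc (1 : ℝ) = ((K : ℝ) / (η * n)) ^ 4 * (η * n / K) ^ 4 := by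
          rw [← mul_pow, div_mul_div_cancel₀ hηn.ne', div_self hK'.ne', one_pow]
      _ ≤ _ := mul_le_mul_of_nonneg_right
          (le_add_of_nonneg_right (Real.exp_pos _).le) (by positivity)
  · simp [literalRate]

theorem exp_literalRate_sub_one_add_lt {α γ : ℝ} (hα : 0 < α) (hγ : 0 < γ) (hαγ : α = 1 - 4 * γ)
    {c : ℕ} (hc : c < 4) :
    Real.exp (literalRate γ c) - 1 + γ * literalRate γ 3 <
      literalRate γ c * (1 - γ) * α⁻¹ := by
  have hγ1 : γ ≤ 1 := by linarith
  have h0 := literalRate_pos hγ c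
  have h1 : literalRate γ c ≤ γ := by
    have := literalRate_anti hγ hγ1 (Nat.zero_le c)
    simpa [literalRate] using this
  have h2 : literalRate γ 3 ≤ literalRate γ c := literalRate_anti hγ hγ1 (by omega)
  have h3 := le_of_abs_le (Real.abs_exp_sub_one_sub_id_le
    (by rw [abs_of_pos h0]; linarith : |literalRate γ c| ≤ 1))
  rw [← div_eq_mul_inv, lt_div_iff₀ hα]
  have h4 : Real.exp (literalRate γ c) - 1 + γ * literalRate γ 3 ≤
      literalRate γ c * (1 + 2 * γ) := by nlinarith
  refine (mul_le_mul_of_nonneg_right h4 hα.le).trans_lt ?_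
  rw [hαγ, mul_assoc]
  refine mul_lt_mul_of_pos_left ?_ h0
  nlinarith

/-- The bound on the number of reached literals: the least integer greater than `log² n / 2`. -/
noncomputable def sizeBound (n : ℕ) : ℕ := ⌊Real.log n ^ 2 / 2⌋₊ + 1

theorem sizeBound_pos (n : ℕ) : 0 < sizeBound n := Nat.succ_pos _

theorem two_mul_le_of_lt_sizeBound {n w : ℕ} (h : w < sizeBound n) :
    2 * (w : ℝ) ≤ Real.log n ^ 2 := by
  have := (Nat.le_floor_iff (by positivity)).1 (Nat.lt_succ_iff.1 h)
  linarith

theorem log_sq_le_sizeBound (n : ℕ) : Real.log n ^ 2 / 2 ≤ sizeBound n := by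
  unfold sizeBound
  push_cast
  exact (Nat.lt_floor_add_one _).le

theorem sizeBound_le (n : ℕ) : (sizeBound n : ℝ) ≤ Real.log n ^ 2 / 2 + 1 := by
  unfold sizeBound
  push_cast
  linarith [Nat.floor_le (by positivity : 0 ≤ Real.log n ^ 2 / 2)]

theorem tendsto_sizeBound_pow_div :
    Tendsto (fun n : ℕ => (sizeBound n : ℝ) ^ 4 / n) atTop (nhds 0) := by
  have h8 : Tendsto (fun n : ℕ => Real.log n ^ 8 / n) atTop (nhds 0) :=
    ((Real.isLittleO_pow_log_id_atTop (n := 8)).tendsto_div_nhds_zero).comp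
      tendsto_natCast_atTop_atTop
  refine squeeze_zero' (Eventually.of_forall fun n => by positivity) ?_ h8
  have hlog : Tendsto (fun n : ℕ => Real.log n) atTop atTop :=
    Real.tendsto_log_atTop.comp tendsto_natCast_atTop_atTop
  filter_upwards [hlog.eventually_ge_atTop 2] with n hn
  have : (sizeBound n : ℝ) ≤ Real.log n ^ 2 := by nlinarith [sizeBound_le n]
  calc (sizeBound n : ℝ) ^ 4 / n ≤ (Real.log n ^ 2) ^ 4 / n := by gcongr
    _ = _ := by rw [← pow_mul]

theorem tendsto_sizeBound_div :
    Tendsto (fun n : ℕ => (sizeBound n : ℝ) / n) atTop (nhds 0) := by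
  refine squeeze_zero (fun n => by positivity) (fun n => ?_) tendsto_sizeBound_pow_div
  have : (1 : ℝ) ≤ sizeBound n := by exact_mod_cast sizeBound_pos n
  gcongr
  exact le_self_pow₀ this (by norm_num)

theorem tendsto_pow_mul_exp_neg_sizeBound {δ : ℝ} (hδ : 0 < δ) :
    Tendsto (fun n : ℕ => (n : ℝ) ^ 3 * Real.exp (-(δ * sizeBound n))) atTop (nhds 0) := by
  have hlog : Tendsto (fun n : ℕ => Real.log n) atTop atTop :=
    Real.tendsto_log_atTop.comp tendsto_natCast_atTop_atTop
  have hneg : Tendsto (fun n : ℕ => Real.exp (-Real.log n)) atTop (nhds 0) :=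
    Real.tendsto_exp_neg_atTop_nhds_zero.comp hlog
  refine squeeze_zero' (Eventually.of_forall fun n => by positivity) ?_ hneg
  filter_upwards [hlog.eventually_ge_atTop (8 / δ), eventually_gt_atTop 0] with n hn hn0
  have h1 : (n : ℝ) ^ 3 = Real.exp (3 * Real.log n) := by
    rw [mul_comm, Real.exp_mul, Real.exp_log (by exact_mod_cast hn0)]
    norm_cast
  rw [h1, ← Real.exp_add]
  refine Real.exp_le_exp.2 ?_
  have h2 : 8 ≤ δ * Real.log n := by
    rw [div_le_iff₀ hδ] at hn
    linarith
  have h3 := mul_le_mul_of_nonneg_left (log_sq_le_sizeBound n) hδ.le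
  have h4 : 0 ≤ Real.log n := Real.log_natCast_nonneg n
  nlinarith [mul_le_mul_of_nonneg_right h2 h4]

theorem eventually_drift {α γ : ℝ} (hα : 0 < α) (hγ : 0 < γ) (hαγ : α = 1 - 4 * γ) {m : ℕ → ℕ}
    (hm : Tendsto (fun n => (m n : ℝ) / (n : ℝ)) atTop (nhds α)) :
    ∀ᶠ n : ℕ in atTop, ∀ c < 4,
      Real.exp (literalRate γ c) - 1 + γ * literalRate γ 3 * (n / ((n : ℝ) - 1)) ≤
        literalRate γ c * (1 - γ) * (((n : ℝ) - sizeBound n) / m n) := by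
  refine (Set.finite_Iio 4).eventually_all.2 fun c hc => ?_
  have h1 : Tendsto (fun n : ℕ => (n : ℝ) / ((n : ℝ) - 1)) atTop (nhds 1) := by
    have h : Tendsto (fun n : ℕ => 1 + (1 : ℝ) / ((n : ℝ) - 1)) atTop (nhds (1 + 0)) :=
      tendsto_const_nhds.add (tendsto_const_nhds.div_atTop
        (tendsto_atTop_add_const_right _ (-1) tendsto_natCast_atTop_atTop))
    rw [add_zero] at h
    refine h.congr' ?_
    filter_upwards [eventually_gt_atTop 1] with n hn
    have : (n : ℝ) - 1 ≠ 0 := sub_ne_zero.2 (by exact_mod_cast hn.ne')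
    field_simp
    ring
  have h2 : Tendsto (fun n : ℕ => ((n : ℝ) - sizeBound n) / m n) atTop (nhds α⁻¹) := by
    have h := (tendsto_const_nhds (x := (1 : ℝ))).sub tendsto_sizeBound_div |>.mul
      (hm.inv₀ hα.ne')
    rw [sub_zero, one_mul] at h
    refine h.congr' ?_
    filter_upwards [eventually_gt_atTop 0] with n hn
    have : (n : ℝ) ≠ 0 := by exact_mod_cast hn.ne'
    rw [inv_div]
    field_simp
  have h3 := (h1.const_mul (γ * literalRate γ 3)).const_add (Real.exp (literalRate γ c) - 1)
  rw [mul_one] at h3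
  have h4 := h2.const_mul (literalRate γ c * (1 - γ))
  exact (h3.eventually_lt h4 (exp_literalRate_sub_one_add_lt hα hγ hαγ hc)).mono
    fun n hn => hn.le

/-- **Corollary 3.6.** For every `0 < α < 1` with `m = m(n) ∼ αn`, with probability `1 − o(n⁻²)`
the random 2-CNF `Φ = Φ_{n,m}` satisfies
`max_{1 ≤ i ≤ n} (|𝒱(Φ,{xᵢ})| + |𝒱(Φ,{¬xᵢ})|) ≤ log² n`. -/
theorem stmt_12 :
    ∀ α : ℝ, 0 < α → α < 1 →
      ∀ m : ℕ → ℕ, Tendsto (fun n => (m n : ℝ) / (n : ℝ)) atTop (nhds α) →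
        ∃ g : ℕ → ℝ,
          Tendsto (fun n : ℕ => (n : ℝ) ^ 2 * g n) atTop (nhds 0) ∧
          ∀ n : ℕ,
            prF n (m n)
                (fun f => ∀ i : Fin n,
                  (((ucpVars (toCNF f) (true, i)).ncard : ℝ) +
                      ((ucpVars (toCNF f) (false, i)).ncard : ℝ)) ≤ (Real.log n) ^ 2) ≥
              1 - g n := by
  intro α hα hα1 m hm
  refine ⟨_, ?_, fun n => (sub_sub_cancel 1 _).le⟩
  obtain ⟨γ, hαγ⟩ : ∃ γ, α = 1 - 4 * γ := ⟨(1 - α) / 4, by ring⟩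
  have hγ : 0 < γ := by linarith
  have hθ := literalRate_pos hγ 3
  set η : ℝ := γ * literalRate γ 3 with hη
  have hη0 : 0 < η := mul_pos hγ hθ
  have hlim : Tendsto (fun n : ℕ => Real.exp γ ^ 2 * ((η ^ 4)⁻¹ * ((sizeBound n : ℝ) ^ 4 / n) +
      (n : ℝ) ^ 3 * Real.exp (-(η * sizeBound n)))) atTop (nhds 0) := by
    have := ((tendsto_sizeBound_pow_div.const_mul (η ^ 4)⁻¹).add
      (tendsto_pow_mul_exp_neg_sizeBound hη0)).const_mul (Real.exp γ ^ 2)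
    simpa using this
  refine squeeze_zero' ?_ ?_ hlim
  · filter_upwards [eventually_ge_atTop 2] with n hn
    rw [one_sub_prF hn]
    positivity
  · filter_upwards [eventually_ge_atTop 2, eventually_drift hα hγ hαγ hm,
      hm.eventually_const_lt hα, tendsto_sizeBound_div.eventually_le_const hη0]
      with n hn hdrift hmn hK
    have hn0 : (0 : ℝ) < n := by
      have : 0 < n := by omega
      exact_mod_cast this
    have hm0 : 0 < m n := by
      have := (div_pos_iff_of_pos_right hn0).1 hmn
      exact_mod_cast this
    obtain ⟨p, ht, hε⟩ := exists_weights hγ (by linarith) hm0 hn (sizeBound_pos n)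
      ((div_le_iff₀ hn0).1 hK) hdrift
    calc (n : ℝ) ^ 2 * _ ≤ (n : ℝ) ^ 2 * (n * (p.ε * p.t 0 ^ 2)) :=
          mul_le_mul_of_nonneg_left
            (one_sub_prF_le p hn fun w hw => two_mul_le_of_lt_sizeBound hw) (by positivity)
      _ = _ := by
          rw [ht, hε, ← hη]
          field_simp
end
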